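/- arXiv:2605.29544 — 3 statements merged into one kernel-verified Lean document; each statement's English description precedes it below -/
import Mathlib

section
/- If x_1, …, x_t is a regular sequence on a module M over a Noetherian ring, then the limit closure (x_1,…,x_t)^{lim}_M equals (x_1,…,x_t)M. -/
/-- The limit closure of the sequence `x_1, …, x_t` in `M`:
`⋃_{n ≥ 1} ((x_1^{n+1},…,x_t^{n+1})M :_M (x_1⋯x_t)^n)`. -/
def limitClosure {R : Type*} [CommRing R] {t : ℕ} (x : Fin t → R)
    (M : Type*) [AddCommGroup M] [Module R M] : Submodule R M :=
  ⨆ n : ℕ, (Ideal.span (Set.range fun i => x i ^ (n + 2)) • (⊤ : Submodule R M)).comap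
    ((∏ i, x i) ^ (n + 1) • (LinearMap.id : M →ₗ[R] M))

/-- `x` is an `M`-regular sequence: each `x_i` is a nonzerodivisor on
`M/(x_1,…,x_{i-1})M`, and `(x_1,…,x_t)M ≠ M`. -/
def IsRegularSeq {R : Type*} [CommRing R] (M : Type*) [AddCommGroup M] [Module R M]
    {t : ℕ} (x : Fin t → R) : Prop :=
  (∀ i : Fin t, ∀ m : M,
      x i • m ∈ (Ideal.span (x '' {j | j < i}) • ⊤ : Submodule R M) →
        m ∈ (Ideal.span (x '' {j | j < i}) • ⊤ : Submodule R M))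
    ∧ (Ideal.span (Set.range x) • (⊤ : Submodule R M)) ≠ ⊤

namespace LimClo

variable {R : Type*} [CommRing R] {M : Type*} [AddCommGroup M] [Module R M]

/-- The submodule generated by the multiples of `y j`, `j ∈ S`. -/
def N (M : Type*) [AddCommGroup M] [Module R M] (y : ℕ → R) (S : Set ℕ) : Submodule R M :=
  Ideal.span (y '' S) • ⊤

lemma N_congr {y z : ℕ → R} {S : Set ℕ} (h : ∀ j ∈ S, y j = z j) : N M y S = N M z S := by
  unfold N
  rw [Set.image_congr h]

lemma mem_insert {y : ℕ → R} {S : Set ℕ} {i : ℕ} {m : M} :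
    m ∈ N M y (insert i S) ↔ ∃ u : M, ∃ n ∈ N M y S, m = y i • u + n := by
  unfold N
  rw [Set.image_insert_eq, Ideal.span_insert, Submodule.sup_smul, Submodule.mem_sup]
  constructor
  · rintro ⟨a, ha, n, hn, rfl⟩
    rw [Submodule.ideal_span_singleton_smul, Submodule.mem_smul_pointwise_iff_exists] at ha
    obtain ⟨u, -, rfl⟩ := ha
    exact ⟨u, n, hn, rfl⟩
  · rintro ⟨u, n, hn, rfl⟩
    exact ⟨_, Submodule.smul_mem_smul (Ideal.mem_span_singleton_self _) trivial, n, hn, rfl⟩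

/-- Weak regularity of the first `k` elements. -/
def Reg (M : Type*) [AddCommGroup M] [Module R M] (y : ℕ → R) (k : ℕ) : Prop :=
  ∀ i < k, ∀ m : M, y i • m ∈ N M y (Set.Iio i) → m ∈ N M y (Set.Iio i)

lemma split {k i : ℕ} (h : i < k) : Set.Iio k = insert i (Set.Iio k \ {i}) := by
  ext j; simp only [Set.mem_Iio, Set.mem_insert_iff, Set.mem_sdiff, Set.mem_singleton_iff]; omega

lemma regA {y : ℕ → R} {k : ℕ} (h : Reg M y k) : ∀ i < k, ∀ m : M,
    y i • m ∈ N M y (Set.Iio k \ {i}) → m ∈ N M y (Set.Iio k \ {i}) := by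
  induction k with
  | zero => intro i hi; omega
  | succ k ih =>
    intro i hi m hm
    have ih := ih (fun i hi => h i (by omega))
    rcases Nat.lt_succ_iff_lt_or_eq.mp hi with hik | rfl
    · have e : Set.Iio (k + 1) \ {i} = insert k (Set.Iio k \ {i}) := by
        ext j
        simp only [Set.mem_Iio, Set.mem_insert_iff, Set.mem_sdiff, Set.mem_singleton_iff]; omega
      rw [e] at hm ⊢
      obtain ⟨u, n, hn, hu⟩ := mem_insert.mp hm
      have h1 : y k • u ∈ N M y (Set.Iio k) := by
        rw [split hik, mem_insert]
        exact ⟨m, -n, neg_mem hn, by rw [hu]; abel⟩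
      have h2 := h k (by omega) u h1
      rw [split hik, mem_insert] at h2
      obtain ⟨w, n', hn', rfl⟩ := h2
      have h3 : y i • (m - y k • w) ∈ N M y (Set.Iio k \ {i}) := by
        have : y i • (m - y k • w) = n + y k • n' := by
          rw [smul_sub, hu, smul_add, smul_comm (y i) (y k)]; abel
        rw [this]
        exact add_mem hn (Submodule.smul_mem _ _ hn')
      exact mem_insert.mpr ⟨w, _, ih i hik _ h3, by abel⟩
    · have e : Set.Iio (i + 1) \ {i} = Set.Iio i := by
        ext j
        simp only [Set.mem_Iio, Set.mem_sdiff, Set.mem_singleton_iff]; omega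
      rw [e] at hm ⊢
      exact h i hi m hm

lemma pow_reg {r : R} {P : Submodule R M} (h : ∀ m : M, r • m ∈ P → m ∈ P) (a : ℕ) :
    ∀ m : M, r ^ a • m ∈ P → m ∈ P := by
  induction a with
  | zero => intro m hm; simpa using hm
  | succ a ih => intro m hm; rw [pow_succ, mul_smul] at hm; exact h _ (ih _ hm)

lemma regPow {x : ℕ → R} {k : ℕ} (h : Reg M x k) : ∀ a : ℕ → ℕ, (∀ j, 0 < a j) →
    Reg M (fun j => x j ^ a j) k := by
  induction k with
  | zero => intro a _ i hi; omega
  | succ k ih =>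
    have ih := ih (fun i hi => h i (by omega))
    have key : ∀ s : ℕ, ∀ a : ℕ → ℕ, (∀ j, 0 < a j) → ∑ j ∈ Finset.range k, a j = s →
        ∀ m : M, x k • m ∈ N M (fun j => x j ^ a j) (Set.Iio k) →
          m ∈ N M (fun j => x j ^ a j) (Set.Iio k) := by
      intro s
      induction s using Nat.strong_induction_on with
      | _ s IH =>
      intro a ha hs m hm
      by_cases hall : ∀ j < k, a j = 1
      · have e : N M (fun j => x j ^ a j) (Set.Iio k) = N M x (Set.Iio k) :=
          N_congr (fun j hj => by simp [hall j hj])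
        rw [e] at hm ⊢
        exact h k (by omega) m hm
      · push Not at hall
        obtain ⟨i, hik, hi⟩ := hall
        obtain ⟨b, hb⟩ : ∃ b, a i = b + 2 := ⟨a i - 2, by have := ha i; omega⟩
        have hlt : ∀ c, c < a i → 0 < c → ∀ m : M,
            x k • m ∈ N M (fun j => x j ^ Function.update a i c j) (Set.Iio k) →
            m ∈ N M (fun j => x j ^ Function.update a i c j) (Set.Iio k) := by
          intro c hc hc0
          refine IH _ ?_ (Function.update a i c) ?_ rfl
          · rw [← hs]
            apply Finset.sum_lt_sum
            · intro j _
              by_cases hj : j = i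
              · subst hj; simp [hc.le]
              · simp [hj]
            · exact ⟨i, Finset.mem_range.mpr hik, by simpa using hc⟩
          · intro j
            by_cases hj : j = i
            · subst hj; simpa using hc0
            · simpa [hj] using ha j
        have hN : ∀ c, N M (fun j => x j ^ Function.update a i c j) (Set.Iio k \ {i}) =
            N M (fun j => x j ^ a j) (Set.Iio k \ {i}) := by
          intro c
          apply N_congr
          rintro j ⟨_, hj⟩
          simp only [Set.mem_singleton_iff] at hj
          simp [hj]
        have hmem : ∀ c (m : M),
            m ∈ N M (fun j => x j ^ Function.update a i c j) (Set.Iio k) ↔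
            ∃ u : M, ∃ n ∈ N M (fun j => x j ^ a j) (Set.Iio k \ {i}), m = x i ^ c • u + n := by
          intro c m
          rw [split hik, mem_insert, hN]
          simp
        have hmem' : ∀ (m : M), m ∈ N M (fun j => x j ^ a j) (Set.Iio k) ↔
            ∃ u : M, ∃ n ∈ N M (fun j => x j ^ a j) (Set.Iio k \ {i}),
              m = x i ^ (b + 2) • u + n := by
          intro m
          rw [← hmem, ← hb, Function.update_eq_self]
        have hA : ∀ m : M, x i ^ (b + 1) • m ∈ N M (fun j => x j ^ a j) (Set.Iio k \ {i}) →
            m ∈ N M (fun j => x j ^ a j) (Set.Iio k \ {i}) := by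
          intro m hm
          have := regA (ih (Function.update a i (b + 1)) (by
            intro j
            by_cases hj : j = i
            · subst hj; simp
            · simpa [hj] using ha j)) i hik m
          rw [hN] at this
          exact this (by simpa using hm)
        rw [hmem'] at hm
        obtain ⟨v, n, hn, hv⟩ := hm
        have h1 := hlt (b + 1) (by omega) (by omega) m (by
          rw [hmem]
          exact ⟨x i • v, n, hn, by rw [hv, smul_smul, ← pow_succ]⟩)
        rw [hmem] at h1
        obtain ⟨u, n1, hn1, rfl⟩ := h1
        have h2 : x i ^ (b + 1) • (x k • u - x i • v) ∈
            N M (fun j => x j ^ a j) (Set.Iio k \ {i}) := by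
          have : x i ^ (b + 1) • (x k • u - x i • v) = n - x k • n1 := by
            rw [smul_sub, smul_smul _ (x i), ← pow_succ, smul_comm, sub_eq_sub_iff_add_eq_add,
              ← smul_add, hv, add_comm]
          rw [this]
          exact sub_mem hn (Submodule.smul_mem _ _ hn1)
        have h3 := hA _ h2
        have h4 := hlt 1 (by omega) (by omega) u (by
          rw [hmem]
          exact ⟨v, _, h3, by rw [pow_one]; abel⟩)
        rw [hmem] at h4
        obtain ⟨w, n2, hn2, rfl⟩ := h4
        rw [hmem']
        refine ⟨w, x i ^ (b + 1) • n2 + n1, add_mem (Submodule.smul_mem _ _ hn2) hn1, ?_⟩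
        rw [smul_add, smul_smul, pow_one, ← pow_succ, add_assoc]
    intro a ha i hi
    rcases Nat.lt_succ_iff_lt_or_eq.mp hi with hik | rfl
    · exact ih a ha i hik
    · exact pow_reg (key _ a ha rfl) (a i)

lemma main {x : ℕ → R} {t : ℕ} (h : Reg M x t) (n : ℕ) (m : M)
    (hm : (∏ i ∈ Finset.Ico 0 t, x i ^ (n + 1)) • m ∈ N M (fun j => x j ^ (n + 2)) (Set.Iio t)) :
    m ∈ N M x (Set.Iio t) := by
  have key : ∀ j ≤ t, (∏ i ∈ Finset.Ico j t, x i ^ (n + 1)) • m ∈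
      N M (fun i => x i ^ (if i < j then 1 else n + 2)) (Set.Iio t) := by
    intro j
    induction j with
    | zero => intro _; simpa using hm
    | succ j ih =>
      intro hj
      have h1 := ih (by omega)
      rw [Finset.prod_eq_prod_Ico_succ_bot (by omega), mul_smul, split (show j < t by omega),
        mem_insert] at h1
      obtain ⟨u, n0, hn0, hu⟩ := h1
      simp only [lt_irrefl, if_false] at hu
      rw [split (show j < t by omega), mem_insert]
      have hA := regA (regPow h (fun i => if i = j then n + 1 else if i < j then 1 else n + 2)
        (by intro i; split_ifs <;> omega)) j (by omega)
        ((∏ i ∈ Finset.Ico (j + 1) t, x i ^ (n + 1)) • m - x j • u)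
      have e1 : N M (fun i => x i ^ (if i = j then n + 1 else if i < j then 1 else n + 2))
          (Set.Iio t \ {j}) = N M (fun i => x i ^ (if i < j then 1 else n + 2))
          (Set.Iio t \ {j}) := by
        apply N_congr
        rintro i ⟨_, hi⟩
        simp only [Set.mem_singleton_iff] at hi
        simp [hi]
      have e2 : N M (fun i => x i ^ (if i < j + 1 then 1 else n + 2))
          (Set.Iio t \ {j}) = N M (fun i => x i ^ (if i < j then 1 else n + 2))
          (Set.Iio t \ {j}) := by
        apply N_congr
        rintro i ⟨_, hi⟩
        simp only [Set.mem_singleton_iff] at hi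
        have : i < j + 1 ↔ i < j := by omega
        simp [this]
      rw [e1] at hA
      rw [e2]
      refine ⟨u, _, hA ?_, by simp⟩
      have : n0 = x j ^ (n + 1) •
          ((∏ i ∈ Finset.Ico (j + 1) t, x i ^ (n + 1)) • m - x j • u) := by
        rw [smul_sub, hu, smul_smul _ (x j), ← pow_succ]; abel
      simpa [← this] using hn0
  have := key t le_rfl
  simp only [Finset.Ico_self, Finset.prod_empty, one_smul] at this
  rwa [N_congr (z := x) (fun j hj => by simp [show j < t from hj])] at this

end LimClo

/-- for a regular sequence, the limit closure equals `(x_1,…,x_t)M`. -/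
theorem limitClosure_eq_of_regular
    {R : Type*} [CommRing R] [IsNoetherianRing R]
    (M : Type*) [AddCommGroup M] [Module R M] [Module.Finite R M]
    {t : ℕ} (x : Fin t → R) (hx : IsRegularSeq M x) :
    limitClosure x M = Ideal.span (Set.range x) • (⊤ : Submodule R M) := by
  obtain ⟨y, hy⟩ : ∃ y : ℕ → R, ∀ i : Fin t, y i = x i :=
    ⟨fun n => if h : n < t then x ⟨n, h⟩ else 0, fun i => by simp⟩
  have hr : ∀ a : ℕ, Set.range (fun i => x i ^ a) = (fun j => y j ^ a) '' Set.Iio t := by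
    intro a
    ext r
    constructor
    · rintro ⟨i, rfl⟩
      exact ⟨i, i.2, by simp [hy]⟩
    · rintro ⟨j, hj, rfl⟩
      exact ⟨⟨j, hj⟩, by simp [← hy]⟩
  have hr1 : Set.range x = y '' Set.Iio t := by simpa using hr 1
  have hreg : LimClo.Reg M y t := by
    intro i hi m hm
    have e : y '' Set.Iio i = x '' {j | j < ⟨i, hi⟩} := by
      ext r
      constructor
      · rintro ⟨j, hj, rfl⟩
        exact ⟨⟨j, lt_trans hj hi⟩, hj, by simp [← hy]⟩
      · rintro ⟨j, hj, rfl⟩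
        exact ⟨j, hj, by simp [hy]⟩
    have := hx.1 ⟨i, hi⟩ m
    rw [← e, ← hy] at this
    exact this hm
  apply le_antisymm
  · refine iSup_le fun n m hm => ?_
    rw [hr1]
    refine LimClo.main hreg n m ?_
    rw [Submodule.mem_comap, hr] at hm
    rw [Nat.Ico_zero_eq_range, ← Fin.prod_univ_eq_prod_range (fun i => y i ^ (n + 1)) t]
    simpa [hy, Finset.prod_pow, LimClo.N] using hm
  · refine le_trans ?_ (le_iSup _ 0)
    rw [Submodule.smul_le]
    intro r hr m _
    rw [Submodule.mem_comap]
    suffices h : (∏ i, x i) * r ∈ Ideal.span (Set.range fun i => x i ^ 2) by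
      have := Submodule.smul_mem_smul h (Submodule.mem_top (x := m) (R := R))
      simpa [mul_smul, smul_comm r] using this
    have hle : Ideal.span (Set.range x) ≤
        Submodule.comap (LinearMap.mulLeft R (∏ i, x i))
          (Ideal.span (Set.range fun i => x i ^ 2)) := by
      rw [Ideal.span_le]
      rintro _ ⟨i, rfl⟩
      change (∏ i, x i) * x i ∈ Ideal.span (Set.range fun i => x i ^ 2)
      rw [← Finset.mul_prod_erase Finset.univ x (Finset.mem_univ i)]
      have : x i * (∏ j ∈ Finset.univ.erase i, x j) * x i =
        (∏ j ∈ Finset.univ.erase i, x j) * x i ^ 2 := by ring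
      rw [this]
      exact Ideal.mul_mem_left _ _ (Ideal.subset_span ⟨i, rfl⟩)
    exact hle hr
end

section
/- Let A be an Artinian module over a Noetherian local ring (R,𝔪) of prime characteristic p, equipped with a Frobenius action F: A → A (an additive map with F(ra) = r^p F(a)). Then there exists a nonnegative integer e such that the nilpotent part 0^F_A = {z ∈ A : F^n(z) = 0 for some n} equals ker(F^e : A → A). -/
open IsLocalRing

theorem charModule_baer (T : Type*) [CommRing T] : Module.Baer T (CharacterModule T) := by
  intro I g
  let ev : CharacterModule T →+ AddCircle (1:ℚ) :=
    { toFun := fun f => f 1, map_zero' := rfl, map_add' := fun _ _ => rfl }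
  obtain ⟨h, hh⟩ := CharacterModule.dual_surjective_of_injective (R := T) (Submodule.subtype I)
    I.injective_subtype (ev.comp g.toAddMonoidHom)
  refine ⟨LinearMap.toSpanSingleton T _ h, fun x hx => ?_⟩
  ext s
  have := DFunLike.congr_fun hh (s • ⟨x, hx⟩)
  simp [ev] at this
  change h (s * x) = g (s • ⟨x, hx⟩) 1 at this
  rw [map_smul] at this
  simp [CharacterModule.smul_apply] at this ⊢
  rw [mul_comm, this]

theorem exists_injHull (T : Type*) [CommRing T] [IsLocalRing T] :
    ∃ (E : Submodule T (CharacterModule T)) (e0 : E), Module.Baer T E ∧ e0 ≠ 0 ∧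
      (∀ x ∈ maximalIdeal T, x • e0 = 0) ∧
      (∀ w : E, (∀ x ∈ maximalIdeal T, x • w = 0) → ∃ c : T, w = c • e0) := by
  classical
  -- the socle element
  obtain ⟨e0, he0, hme0⟩ : ∃ e0 : CharacterModule T, e0 ≠ 0 ∧
      ∀ x ∈ maximalIdeal T, x • e0 = 0 := by
    have h1 : (1 : T ⧸ maximalIdeal T) ≠ 0 := one_ne_zero
    obtain ⟨c, hc⟩ := CharacterModule.exists_character_apply_ne_zero_of_ne_zero h1
    refine ⟨c.comp (Ideal.Quotient.mk (maximalIdeal T)).toAddMonoidHom, ?_, ?_⟩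
    · intro h
      exact hc (DFunLike.congr_fun h (1 : T))
    · intro x hx
      ext s
      change c (Ideal.Quotient.mk _ (x • s)) = 0
      have : Ideal.Quotient.mk (maximalIdeal T) (x • s) = 0 :=
        Ideal.Quotient.eq_zero_iff_mem.2 (Ideal.mul_mem_right _ _ hx)
      rw [this, map_zero]
  let good : Set (Submodule T (CharacterModule T)) := {W | ∀ w ∈ W, w ≠ 0 → ∃ r : T, r • w = e0}
  have hg0 : Submodule.span T {e0} ∈ good := by
    intro w hw hne
    obtain ⟨c, rfl⟩ := Submodule.mem_span_singleton.1 hw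
    have hc : IsUnit c := by
      by_contra hc
      exact hne (hme0 c ((mem_maximalIdeal c).2 hc))
    obtain ⟨u, rfl⟩ := hc
    exact ⟨((u⁻¹ : Tˣ) : T), by rw [smul_smul]; simp⟩
  obtain ⟨E, hE0, hEmax⟩ := zorn_le_nonempty₀ good (by
    intro c hc hchain y hy
    refine ⟨sSup c, ?_, fun z hz => le_sSup hz⟩
    intro w hw hne
    obtain ⟨W, hWc, hwW⟩ := (Submodule.mem_sSup_of_directed ⟨y, hy⟩ hchain.directedOn).1 hw
    exact hc hWc w hwW hne) _ hg0
  have hEg : E ∈ good := hEmax.prop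
  have he0E : e0 ∈ E := hE0 (Submodule.mem_span_singleton_self e0)
  -- complement
  let dis : Set (Submodule T (CharacterModule T)) := {C | ∀ x ∈ C, x ∈ E → x = 0}
  obtain ⟨C, -, hCmax⟩ := zorn_le_nonempty₀ dis (by
    intro c hc hchain y hy
    refine ⟨sSup c, ?_, fun z hz => le_sSup hz⟩
    intro w hw hne
    obtain ⟨W, hWc, hwW⟩ := (Submodule.mem_sSup_of_directed ⟨y, hy⟩ hchain.directedOn).1 hw
    exact hc hWc w hwW hne) ⊥ (by intro x hx _; simpa using hx)
  have hCd : C ∈ dis := hCmax.prop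
  have hbaer := charModule_baer T
  obtain ⟨g, hg⟩ := hbaer.extension_property (C.mkQ ∘ₗ E.subtype) (by
    rw [← LinearMap.ker_eq_bot, LinearMap.ker_eq_bot']
    intro x hx
    have : (x : CharacterModule T) ∈ C := by simpa using hx
    exact Subtype.ext (hCd _ this x.2)) E.subtype
  have hgE : ∀ x ∈ E, g (C.mkQ x) = x := fun x hx => LinearMap.congr_fun hg ⟨x, hx⟩
  have hrange : LinearMap.range (g ∘ₗ C.mkQ) ≤ E := by
    refine hEmax.le_of_ge (y := LinearMap.range (g ∘ₗ C.mkQ)) ?_ ?_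
    · rintro w ⟨y, rfl⟩ hne
      have hy : y ∉ C := by
        intro hy
        apply hne
        have : C.mkQ y = 0 := by simpa using hy
        rw [LinearMap.comp_apply, this, map_zero]
      have : ¬ (C ⊔ Submodule.span T {y} ∈ dis) := by
        intro h
        exact hy (hCmax.le_of_ge h le_sup_left
          (Submodule.mem_sup_right (Submodule.mem_span_singleton_self y)))
      simp only [dis, Set.mem_ofPred_eq] at this
      push Not at this
      obtain ⟨x, hx, hxE, hx0⟩ := this
      obtain ⟨c, hc, z, hz, rfl⟩ := Submodule.mem_sup.1 hx
      obtain ⟨r, rfl⟩ := Submodule.mem_span_singleton.1 hz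
      obtain ⟨s, hs⟩ := hEg _ hxE hx0
      refine ⟨s * r, ?_⟩
      have h1 : C.mkQ (c + r • y) = r • C.mkQ y := by
        have : C.mkQ c = 0 := by simpa using hc
        rw [map_add, this, zero_add, map_smul]
      have h2 := hgE _ hxE
      rw [h1, map_smul] at h2
      rw [← hs, ← h2, mul_smul]; rfl
    · intro x hx
      exact ⟨x, hgE x hx⟩
  refine ⟨E, ⟨e0, he0E⟩, ?_, ?_, ?_, ?_⟩
  · intro I f
    obtain ⟨h, hh⟩ := hbaer I (E.subtype ∘ₗ f)
    refine ⟨LinearMap.codRestrict E (g ∘ₗ C.mkQ ∘ₗ h) (fun x => hrange ⟨h x, rfl⟩), ?_⟩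
    intro x hx
    apply Subtype.ext
    change g (C.mkQ (h x)) = _
    rw [hh x hx]
    exact hgE _ (f ⟨x, hx⟩).2
  · intro h; exact he0 (congrArg Subtype.val h)
  · intro x hx; exact Subtype.ext (hme0 x hx)
  · intro w hw
    by_cases hw0 : w = 0
    · exact ⟨0, by simp [hw0]⟩
    obtain ⟨r, hr⟩ := hEg w w.2 (fun h => hw0 (Subtype.ext h))
    have hru : IsUnit r := by
      by_contra hc
      apply he0
      rw [← hr]
      exact congrArg Subtype.val (hw r ((mem_maximalIdeal r).2 hc))
    obtain ⟨u, rfl⟩ := hru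
    refine ⟨((u⁻¹ : Tˣ) : T), Subtype.ext ?_⟩
    change (w : CharacterModule T) = _ • e0
    rw [← hr, smul_smul]; simp

theorem baer_factor {T : Type*} [CommRing T]
    {E : Type*} [AddCommGroup E] [Module T E] (hE : Module.Baer T E)
    {X Y : Type*} [AddCommGroup X] [Module T X] [AddCommGroup Y] [Module T Y]
    (g : X →ₗ[T] Y) (f : X →ₗ[T] E) (hgf : LinearMap.ker g ≤ LinearMap.ker f) :
    ∃ h : Y →ₗ[T] E, ∀ x, h (g x) = f x := by
  obtain ⟨h, hh⟩ := hE.extension_property ((LinearMap.ker g).liftQ g le_rfl)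
    (by rw [← LinearMap.ker_eq_bot]; exact Submodule.ker_liftQ_eq_bot _ _ _ le_rfl)
    ((LinearMap.ker g).liftQ f hgf)
  exact ⟨h, fun x => LinearMap.congr_fun hh (Submodule.Quotient.mk x)⟩


theorem torsion_of_artinian {T : Type*} [CommRing T] [IsLocalRing T]
    (hfg : (maximalIdeal T).FG) {A : Type*} [AddCommGroup A] [Module T A] [IsArtinian T A]
    (a : A) : ∃ n : ℕ, ∀ x ∈ maximalIdeal T ^ n, x • a = 0 := by
  let f : ℕ →o (Submodule T A)ᵒᵈ :=
    ⟨fun n => OrderDual.toDual ((maximalIdeal T ^ n) • Submodule.span T {a}), fun i j h =>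
      Submodule.smul_mono_left (Ideal.pow_le_pow_right h)⟩
  obtain ⟨n, hn⟩ := IsArtinian.monotone_stabilizes f
  have h1 : (maximalIdeal T ^ n) • Submodule.span T {a} =
      (maximalIdeal T ^ (n+1)) • Submodule.span T {a} := hn (n+1) (Nat.le_succ n)
  have h2 : (maximalIdeal T ^ n) • Submodule.span T {a} = ⊥ := by
    refine Submodule.eq_bot_of_le_smul_of_le_jacobson_bot (maximalIdeal T) _ ?_ ?_
      (IsLocalRing.maximalIdeal_le_jacobson _)
    · exact Submodule.FG.smul (Ideal.FG.pow hfg) (Submodule.fg_span_singleton a)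
    · rw [← mul_smul, ← pow_succ', ← h1]
  refine ⟨n, fun x hx => ?_⟩
  have : x • a ∈ (maximalIdeal T ^ n) • Submodule.span T {a} :=
    Submodule.smul_mem_smul hx (Submodule.mem_span_singleton_self a)
  rw [h2] at this
  simpa using this

theorem cogenerator {T : Type*} [CommRing T] [IsLocalRing T]
    {E : Type*} [AddCommGroup E] [Module T E] (hE : Module.Baer T E) (e0 : E) (he0 : e0 ≠ 0)
    (hm : ∀ x ∈ maximalIdeal T, x • e0 = 0)
    {B : Type*} [AddCommGroup B] [Module T B] (K : Submodule T B) (b : B) (hb : b ∉ K) :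
    ∃ f : B →ₗ[T] E, (∀ k ∈ K, f k = 0) ∧ f b ≠ 0 := by
  let φ : T →ₗ[T] B ⧸ K := LinearMap.toSpanSingleton T _ (K.mkQ b)
  have hker : LinearMap.ker φ ≤ LinearMap.ker (LinearMap.toSpanSingleton T E e0) := by
    intro x hx
    have hx' : x • b ∈ K := by
      have : K.mkQ (x • b) = 0 := by
        rw [map_smul]; exact hx
      exact (Submodule.Quotient.mk_eq_zero K).1 this
    have : x ∈ maximalIdeal T := by
      rw [mem_maximalIdeal, mem_nonunits_iff]
      rintro ⟨u, rfl⟩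
      apply hb
      have := K.smul_mem ((u⁻¹ : Tˣ) : T) hx'
      rw [smul_smul] at this
      simpa using this
    simpa using hm x this
  obtain ⟨h, hh⟩ := baer_factor hE φ (LinearMap.toSpanSingleton T E e0) hker
  have h1 := hh 1
  refine ⟨h ∘ₗ K.mkQ, ?_, ?_⟩
  · intro k hk
    have : K.mkQ k = 0 := by simpa using hk
    rw [LinearMap.comp_apply, this, map_zero]
  · intro h0
    apply he0
    rw [LinearMap.toSpanSingleton_apply, one_smul] at h1
    rw [LinearMap.toSpanSingleton_apply, one_smul] at h1
    rw [← h1]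
    exact h0

theorem isPrecomplete_pi {T : Type*} [CommRing T] (I : Ideal T) [IsPrecomplete I T]
    (ι : Type*) [Fintype ι] : IsPrecomplete I (ι → T) := by
  classical
  have key : ∀ (n : ℕ) (x : ι → T), x ∈ (I ^ n • ⊤ : Submodule T (ι → T)) ↔
      ∀ i, x i ∈ (I ^ n • ⊤ : Submodule T T) := by
    intro n x
    constructor
    · intro hx i
      have := Submodule.mem_map_of_mem (f := LinearMap.proj (R := T) (φ := fun _ : ι => T) i) hx
      rw [Submodule.map_smul''] at this
      exact (Submodule.smul_mono le_rfl le_top) this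
    · intro h
      rw [← Finset.univ_sum_single x]
      refine Submodule.sum_mem _ fun i _ => ?_
      have h2 : Pi.single i (x i) = x i • (Pi.single i 1 : ι → T) := by
        rw [← Pi.single_smul]; simp
      rw [h2]
      refine Submodule.smul_mem_smul ?_ trivial
      simpa using h i
  refine ⟨fun f hf => ?_⟩
  have : ∀ i, ∃ L : T, ∀ n, f n i ≡ L [SMOD (I ^ n • ⊤ : Submodule T T)] := by
    intro i
    refine IsPrecomplete.prec ‹_› (f := fun n => f n i) fun {m n} hmn => ?_
    have := hf hmn
    rw [SModEq.sub_mem] at this ⊢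
    exact (key _ _).1 this i
  choose L hL using this
  refine ⟨L, fun n => ?_⟩
  rw [SModEq.sub_mem, key]
  intro i
  have := hL i n
  rw [SModEq.sub_mem] at this
  exact this

theorem dual_isNoetherian {T : Type*} [CommRing T] [IsLocalRing T]
    (hfg : (maximalIdeal T).FG) [IsPrecomplete (maximalIdeal T) T]
    {E : Type*} [AddCommGroup E] [Module T E] (hE : Module.Baer T E) (e0 : E)
    (hm : ∀ x ∈ maximalIdeal T, x • e0 = 0)
    (hsoc : ∀ w : E, (∀ x ∈ maximalIdeal T, x • w = 0) → ∃ c : T, w = c • e0)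
    (A : Type*) [AddCommGroup A] [Module T A] [IsArtinian T A] :
    IsNoetherian T (A →ₗ[T] E) := by
  classical
  refine ⟨fun N => ?_⟩
  obtain ⟨s, hs⟩ := Finset.exists_inf_le (fun f : N => LinearMap.ker (f : A →ₗ[T] E))
  -- the common kernel
  let Z : Submodule T A := s.inf (fun f : N => LinearMap.ker (f : A →ₗ[T] E))
  have hZ : ∀ a, a ∈ Z ↔ ∀ f ∈ s, (f : A →ₗ[T] E) a = 0 := by
    intro a; simp [Z, Submodule.mem_finsetInf]
  let Nb : Submodule T (A →ₗ[T] E) :=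
    { carrier := {f | ∀ z ∈ Z, f z = 0}
      zero_mem' := fun z _ => rfl
      add_mem' := fun {f g} hf hg z hz => by simp [hf z hz, hg z hz]
      smul_mem' := fun c f hf z hz => by simp [hf z hz] }
  have hNNb : N ≤ Nb := fun f hf z hz => hs ⟨f, hf⟩ hz
  let L : Submodule T A :=
    { carrier := {a | ∀ x ∈ maximalIdeal T, x • a ∈ Z}
      zero_mem' := fun x _ => by simp
      add_mem' := fun {a b} ha hb x hx => by
        rw [smul_add]; exact Z.add_mem (ha x hx) (hb x hx)
      smul_mem' := fun c a ha x hx => by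
        rw [smul_comm]; exact Z.smul_mem c (ha x hx) }
  -- Step 1 : functionals vanishing on L lie in m • Nb
  have step1 : ∀ f : A →ₗ[T] E, (∀ a ∈ L, f a = 0) → ∃ h : Nb, (h : A →ₗ[T] E) = f ∧
      h ∈ (maximalIdeal T • ⊤ : Submodule T Nb) := by
    intro f hf
    obtain ⟨G, hG⟩ := hfg
    let g : A →ₗ[T] (G → A ⧸ Z) := LinearMap.pi fun x => (x : T) • Z.mkQ
    have hgk : LinearMap.ker g ≤ L := by
      intro a ha x hx
      have h1 : maximalIdeal T ≤ Z.colon {a} := by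
        rw [← hG, Ideal.span, Submodule.span_le]
        intro y hy
        have : g a ⟨y, hy⟩ = 0 := by rw [LinearMap.mem_ker.1 ha]; rfl
        have h3 : Z.mkQ (y • a) = 0 := by rw [map_smul]; exact this
        rw [SetLike.mem_coe, Submodule.mem_colon_singleton]
        exact (Submodule.Quotient.mk_eq_zero Z).1 h3
      exact Submodule.mem_colon_singleton.1 (h1 hx)
    obtain ⟨h, hh⟩ := baer_factor hE g f (fun a ha => hf a (hgk ha))
    let hc : G → Nb := fun x => ⟨h ∘ₗ LinearMap.single T _ x ∘ₗ Z.mkQ, fun z hz => by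
      have : Z.mkQ z = 0 := by simpa using hz
      rw [LinearMap.comp_apply, LinearMap.comp_apply, this, map_zero, map_zero]⟩
    refine ⟨∑ x : G, (x : T) • hc x, ?_, ?_⟩
    · ext a
      have h1 := hh a
      rw [← h1, ← Finset.univ_sum_single (g a), map_sum]
      simp only [AddSubmonoidClass.coe_finsetSum, LinearMap.sum_apply]
      refine Finset.sum_congr rfl fun x _ => ?_
      have h4 : g a x = (x : T) • Z.mkQ a := rfl
      rw [h4, ← LinearMap.single_apply (R := T), map_smul, map_smul]
      rfl
    · refine Submodule.sum_mem _ fun x _ => Submodule.smul_mem_smul ?_ trivial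
      rw [← hG]; exact Ideal.subset_span x.2
  -- Step 2
  have step2 : ∀ f ∈ Nb, ∃ c : s → T, ∀ a ∈ L,
      f a = ∑ i : s, c i • ((i : N) : A →ₗ[T] E) a := by
    intro f hf
    let g : L →ₗ[T] (s → E) := LinearMap.pi fun i => ((i : N) : A →ₗ[T] E) ∘ₗ L.subtype
    have hgk : LinearMap.ker g ≤ LinearMap.ker (f ∘ₗ L.subtype) := by
      intro a ha
      apply hf
      rw [hZ]
      intro i hi
      exact congrFun (LinearMap.mem_ker.1 ha) ⟨i, hi⟩
    obtain ⟨h, hh⟩ := baer_factor hE g (f ∘ₗ L.subtype) hgk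
    have hc : ∀ i : s, ∃ c : T, h (LinearMap.single T _ i e0) = c • e0 := by
      intro i
      apply hsoc
      intro x hx
      rw [← map_smul, ← map_smul, hm x hx, map_zero, map_zero]
    choose c hc using hc
    refine ⟨c, fun a ha => ?_⟩
    have h1 := hh ⟨a, ha⟩
    rw [LinearMap.comp_apply, Submodule.subtype_apply] at h1
    rw [← h1, ← Finset.univ_sum_single (g ⟨a, ha⟩), map_sum]
    refine Finset.sum_congr rfl fun i _ => ?_
    have h4 : g ⟨a, ha⟩ i = ((i : N) : A →ₗ[T] E) a := rfl
    obtain ⟨d, hd⟩ := hsoc (((i : N) : A →ₗ[T] E) a) (fun x hx => by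
      rw [← map_smul]
      exact (hZ _).1 (ha x hx) i i.2)
    rw [h4, hd, ← LinearMap.single_apply (R := T), map_smul, map_smul, hc, smul_comm]
  -- Hausdorff
  have haus : IsHausdorff (maximalIdeal T) Nb := by
    refine ⟨fun f hf => ?_⟩
    apply Subtype.ext
    ext a
    obtain ⟨n, hn⟩ := torsion_of_artinian hfg a
    have h1 := hf n
    rw [SModEq.zero] at h1
    have h2 : ∀ g ∈ (maximalIdeal T ^ n • ⊤ : Submodule T Nb), (g : A →ₗ[T] E) a = 0 := by
      intro g hg
      refine Submodule.smul_induction_on hg ?_ ?_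
      · intro r hr k _
        change r • (k : A →ₗ[T] E) a = 0
        rw [← map_smul, hn r hr, map_zero]
      · intro x y hx hy
        change (x : A →ₗ[T] E) a + (y : A →ₗ[T] E) a = 0
        rw [hx, hy, add_zero]
    exact h2 f h1
  have := isPrecomplete_pi (maximalIdeal T) s
  let Φ : (s → T) →ₗ[T] Nb :=
    Fintype.linearCombination T (fun i : s => (⟨((i : N) : A →ₗ[T] E), hNNb (i : N).2⟩ : Nb))
  have hΦ : ∀ c, (Φ c : A →ₗ[T] E) = ∑ i : s, c i • ((i : N) : A →ₗ[T] E) := by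
    intro c
    simp [Φ, Fintype.linearCombination_apply]
  have hsurj : Function.Surjective Φ := by
    refine surjective_of_mkQ_comp_surjective (I := maximalIdeal T) ?_
    intro y
    obtain ⟨f, rfl⟩ := Submodule.mkQ_surjective _ y
    obtain ⟨c, hc⟩ := step2 f f.2
    refine ⟨c, ?_⟩
    obtain ⟨h, hh1, hh2⟩ := step1 ((Φ c : A →ₗ[T] E) - f) (by
      intro a ha
      rw [LinearMap.sub_apply, hΦ, hc a ha]
      simp)
    have h5 : h = Φ c - f := Subtype.ext hh1
    rw [h5] at hh2
    rw [LinearMap.comp_apply, Submodule.mkQ_apply, Submodule.mkQ_apply, Submodule.Quotient.eq]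
    exact hh2
  -- conclude
  refine ⟨s.image Subtype.val, le_antisymm ?_ ?_⟩
  · rw [Submodule.span_le]
    intro f hf
    simp only [Finset.coe_image, Set.mem_image] at hf
    obtain ⟨g, _, rfl⟩ := hf
    exact g.2
  · intro f hf
    obtain ⟨c, hc⟩ := hsurj ⟨f, hNNb hf⟩
    have : f = ∑ i : s, c i • ((i : N) : A →ₗ[T] E) := by
      rw [← hΦ, hc]
    rw [this]
    refine Submodule.sum_mem _ fun i _ => Submodule.smul_mem _ _ (Submodule.subset_span ?_)
    simp only [Finset.coe_image, Set.mem_image]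
    exact ⟨i, i.2, rfl⟩

theorem local_stab {B : Type*} [CommRing B] [IsNoetherianRing B] {M : Type*} [AddCommGroup M]
    [Module B M] [Module.Finite B M] (P : Ideal B) (hP : P ∈ minimalPrimes B)
    (Ms : ℕ → Submodule B M) (hMs : Antitone Ms) :
    ∃ e : ℕ, ∃ s : B, s ∉ P ∧ ∀ x ∈ Ms e, s • x ∈ Ms (e + 1) := by
  classical
  have hPp : P.IsPrime := hP.1.1
  let Q := Localization.AtPrime P
  have hQN : IsNoetherianRing Q := IsLocalization.isNoetherianRing P.primeCompl Q inferInstance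
  have hdim : Ring.KrullDimLE 0 Q := by
    refine Ring.KrullDimLE.mk₀ fun I hI => ?_
    have h1 : I ≤ maximalIdeal Q := IsLocalRing.le_maximalIdeal hI.ne_top
    have h2 : I.under B = P := by
      have h3 : I.under B ≤ P := by
        have h5 : I.under B ≤ (maximalIdeal Q).under B := Ideal.comap_mono h1
        rwa [Localization.AtPrime.under_maximalIdeal] at h5
      exact le_antisymm h3 (hP.2 ⟨Ideal.comap_isPrime _ _, bot_le⟩ h3)
    have h4 : I = maximalIdeal Q := by
      rw [← IsLocalization.map_under P.primeCompl Q I, h2, Localization.AtPrime.map_eq_maximalIdeal]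
    rw [h4]; infer_instance
  have hQA : IsArtinianRing Q := isArtinianRing_iff_krullDimLE_zero.2 hdim
  have hfin : Module.Finite Q (LocalizedModule P.primeCompl M) :=
    Module.Finite.of_isLocalizedModule P.primeCompl (LocalizedModule.mkLinearMap P.primeCompl M)
  have hart : IsArtinian Q (LocalizedModule P.primeCompl M) := inferInstance
  let f : ℕ →o (Submodule Q (LocalizedModule P.primeCompl M))ᵒᵈ :=
    ⟨fun e => OrderDual.toDual ((Ms e).localized P.primeCompl), fun i j h => by
      rintro x hx
      obtain ⟨m, hm, t, rfl⟩ := hx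
      exact ⟨m, hMs h hm, t, rfl⟩⟩
  obtain ⟨e, he⟩ := IsArtinian.monotone_stabilizes f
  have h1 : (Ms e).localized P.primeCompl = (Ms (e+1)).localized P.primeCompl :=
    he (e+1) (Nat.le_succ e)
  have h2 : ∀ x ∈ Ms e, ∃ t : B, t ∉ P ∧ t • x ∈ Ms (e+1) := by
    intro x hx
    have h3 : LocalizedModule.mk x 1 ∈ (Ms e).localized P.primeCompl :=
      ⟨x, hx, 1, by rw [← IsLocalizedModule.mk_eq_mk']⟩
    rw [h1] at h3
    obtain ⟨y, hy, t, hyt⟩ := h3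
    rw [← IsLocalizedModule.mk_eq_mk', LocalizedModule.mk_eq] at hyt
    obtain ⟨u, hu⟩ := hyt
    refine ⟨u * t, P.primeCompl.mul_mem u.2 t.2, ?_⟩
    have h5 : ((u : B) * t) • x = (u : B) • y := by
      rw [mul_smul]
      have : u • (1 : P.primeCompl) • y = u • t • x := hu
      rw [one_smul] at this
      exact this.symm
    rw [h5]
    exact Submodule.smul_mem _ _ hy
  obtain ⟨G, hG⟩ : (Ms e).FG := IsNoetherian.noetherian _
  have h3 : ∀ x : G, ∃ t : B, t ∉ P ∧ t • (x : M) ∈ Ms (e+1) := fun x =>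
    h2 x (hG ▸ Submodule.subset_span x.2)
  choose t ht htm using h3
  refine ⟨e, ∏ x : G, t x, ?_, ?_⟩
  · exact P.primeCompl.prod_mem (fun x _ => ht x)
  · have h6 : Ms e ≤ (Ms (e+1)).comap (LinearMap.lsmul B M (∏ x : G, t x)) := by
      rw [← hG, Submodule.span_le]
      intro x hx
      change (∏ x : G, t x) • x ∈ Ms (e+1)
      rw [← Finset.prod_erase_mul _ _ (Finset.mem_univ (⟨x, hx⟩ : G)), mul_smul]
      exact Submodule.smul_mem _ _ (htm ⟨x, hx⟩)
    exact fun x hx => h6 hx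

theorem noeth_quot_ann {T : Type*} [CommRing T] {M : Type*} [AddCommGroup M] [Module T M]
    [IsNoetherian T M] : IsNoetherianRing (T ⧸ Module.annihilator T M) := by
  obtain ⟨G, hG⟩ : (⊤ : Submodule T M).FG := IsNoetherian.noetherian _
  let φ : T →ₗ[T] (G → M) := LinearMap.pi fun x => LinearMap.toSpanSingleton T M x
  have hφ : LinearMap.ker φ ≤ Module.annihilator T M := by
    intro t ht
    rw [Module.mem_annihilator]
    intro m
    have h6 : (⊤ : Submodule T M) ≤ LinearMap.ker (LinearMap.lsmul T M t) := by
      rw [← hG, Submodule.span_le]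
      intro x hx
      exact congrFun (LinearMap.mem_ker.1 ht) ⟨x, hx⟩
    exact h6 (x := m) trivial
  have h1 : IsNoetherian T (T ⧸ LinearMap.ker φ) :=
    isNoetherian_of_injective ((LinearMap.ker φ).liftQ φ le_rfl)
      (LinearMap.ker_eq_bot.1 (Submodule.ker_liftQ_eq_bot _ _ _ le_rfl))
  have h2 : IsNoetherian T (T ⧸ Module.annihilator T M) :=
    isNoetherian_of_surjective (f := Submodule.factor hφ)
      (LinearMap.range_eq_top.2 (Submodule.factor_surjective hφ))
  exact isNoetherian_of_tower T h2

theorem chain_lemma {T : Type*} [CommRing T] [IsLocalRing T]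
    (hfg : (maximalIdeal T).FG) [IsPrecomplete (maximalIdeal T) T]
    (B : Type*) [AddCommGroup B] [Module T B] [IsArtinian T B] [Nontrivial B]
    (K : ℕ → Submodule T B) (hK : Monotone K)
    (b : Ideal T) (hb : ∀ x ∈ b, ∀ a : B, x ^ 2 • a = 0) :
    ∃ e : ℕ, ∃ s : T, s ∉ b ∧ ∀ a ∈ K (e + 1), s • a ∈ K e := by
  obtain ⟨E, e0, hE, he0, hm, hsoc⟩ := exists_injHull T
  have hN := dual_isNoetherian hfg hE e0 hm hsoc B
  have hRN : IsNoetherianRing (T ⧸ Module.annihilator T (B →ₗ[T] E)) := noeth_quot_ann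
  let _ : Module (T ⧸ Module.annihilator T (B →ₗ[T] E)) (B →ₗ[T] E) := Module.quotientAnnihilator
  have hsm : ∀ (t : T) (f : B →ₗ[T] E),
      (Ideal.Quotient.mk (Module.annihilator T (B →ₗ[T] E)) t) • f = t • f := fun t f => rfl
  have htower : IsScalarTower T (T ⧸ Module.annihilator T (B →ₗ[T] E)) (B →ₗ[T] E) := by
    refine ⟨fun t q f => ?_⟩
    obtain ⟨q, rfl⟩ := Ideal.Quotient.mk_surjective q
    have : t • (Ideal.Quotient.mk (Module.annihilator T (B →ₗ[T] E)) q) =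
      (Ideal.Quotient.mk (Module.annihilator T (B →ₗ[T] E)) (t * q)) := rfl
    rw [this, hsm, hsm, mul_smul]
  have hfin : Module.Finite (T ⧸ Module.annihilator T (B →ₗ[T] E)) (B →ₗ[T] E) :=
    Module.Finite.of_restrictScalars_finite T _ _
  have hnt : Nontrivial (T ⧸ Module.annihilator T (B →ₗ[T] E)) := by
    obtain ⟨a, ha⟩ := exists_ne (0 : B)
    obtain ⟨f, -, hf⟩ := cogenerator hE e0 he0 hm (⊥ : Submodule T B) a (by simpa using ha)
    rw [Ideal.Quotient.nontrivial_iff]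
    intro h
    have h1 : (1 : T) ∈ Module.annihilator T (B →ₗ[T] E) := by rw [h]; trivial
    rw [Module.mem_annihilator] at h1
    have := h1 f
    rw [one_smul] at this
    exact hf (by rw [this]; rfl)
  obtain ⟨⟨P, hP⟩⟩ := Ideal.nonempty_minimalPrimes
    (I := (⊥ : Ideal (T ⧸ Module.annihilator T (B →ₗ[T] E)))) bot_ne_top
  have hPp : P.IsPrime := hP.1.1
  let Ms : ℕ → Submodule (T ⧸ Module.annihilator T (B →ₗ[T] E)) (B →ₗ[T] E) := fun e =>
    { carrier := {f | ∀ a ∈ K e, f a = 0}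
      zero_mem' := fun z _ => rfl
      add_mem' := fun {f g} hf hg z hz => by simp [hf z hz, hg z hz]
      smul_mem' := fun c f hf z hz => by
        obtain ⟨c, rfl⟩ := Ideal.Quotient.mk_surjective c
        rw [hsm]
        simp [hf z hz] }
  obtain ⟨e, s, hsP, hs⟩ := local_stab P hP Ms (fun i j hij f hf a ha => hf a (hK hij ha))
  obtain ⟨s, rfl⟩ := Ideal.Quotient.mk_surjective s
  refine ⟨e, s, ?_, ?_⟩
  · intro hsb
    apply hsP
    apply hPp.mem_of_pow_mem 2
    rw [← map_pow]
    have : Ideal.Quotient.mk (Module.annihilator T (B →ₗ[T] E)) (s ^ 2) = 0 := by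
      rw [Ideal.Quotient.eq_zero_iff_mem, Module.mem_annihilator]
      intro f
      ext a
      rw [LinearMap.smul_apply, ← map_smul, hb s hsb, map_zero]; rfl
    rw [this]
    exact P.zero_mem
  · intro a ha
    by_contra hna
    obtain ⟨f, hf, hfa⟩ := cogenerator hE e0 he0 hm (K e) (s • a) hna
    apply hfa
    have h1 : (s • f) a = 0 := hs f hf a ha
    rw [map_smul]; exact h1

/-- The theorem over a complete local ring. -/
theorem hsl_complete {T : Type*} [CommRing T] [IsLocalRing T]
    (hfg : (maximalIdeal T).FG) [IsPrecomplete (maximalIdeal T) T]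
    (p : ℕ) (hp : 2 ≤ p)
    (A : Type*) [AddCommGroup A] [Module T A] [IsArtinian T A]
    (F : AddMonoid.End A) (hF : ∀ (r : T) (a : A), F (r • a) = r ^ p • F a) :
    ∃ e : ℕ, ∀ z : A, (∃ n : ℕ, (F ^ n) z = 0) → (F ^ e) z = 0 := by
  have hFn : ∀ (n : ℕ) (r : T) (a : A), (F ^ n) (r • a) = r ^ (p ^ n) • (F ^ n) a := by
    intro n
    induction n with
    | zero => intro r a; simp
    | succ n ih =>
      intro r a
      have hs1 : ∀ a, (F ^ (n + 1)) a = (F ^ n) (F a) := fun a => by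
        rw [pow_succ]; rfl
      rw [hs1, hs1, hF, ih, ← pow_mul,
        pow_succ, mul_comm]
  have hsucc : ∀ (n : ℕ) (a : A), (F ^ (n + 1)) a = (F ^ n) (F a) := fun n a => by
    rw [pow_succ]; rfl
  have hsucc' : ∀ (n : ℕ) (a : A), (F ^ (n + 1)) a = F ((F ^ n) a) := fun n a => by
    rw [pow_succ']; rfl
  let K : ℕ → Submodule T A := fun n =>
    { carrier := {a | (F ^ n) a = 0}
      zero_mem' := map_zero _
      add_mem' := fun {a b} ha hb => by
        change (F ^ n) (a + b) = 0
        rw [map_add, show (F ^ n) a = 0 from ha, show (F ^ n) b = 0 from hb, add_zero]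
      smul_mem' := fun c a ha => by
        change (F ^ n) (c • a) = 0
        rw [hFn, show (F ^ n) a = 0 from ha, smul_zero] }
  have hKmem : ∀ n a, a ∈ K n ↔ (F ^ n) a = 0 := fun n a => Iff.rfl
  have hKmono : Monotone K := by
    refine monotone_nat_of_le_succ fun n a ha => ?_
    rw [hKmem] at ha ⊢
    rw [hsucc', ha, map_zero]
  have hFK : ∀ n a, F a ∈ K n ↔ a ∈ K (n + 1) := fun n a => by
    rw [hKmem, hKmem, hsucc]
  let b : ℕ → Ideal T := fun n =>
    { carrier := {x | ∀ a ∈ K (n + 1), x • a ∈ K n}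
      zero_mem' := fun a _ => by rw [zero_smul]; exact (K n).zero_mem
      add_mem' := fun {x y} hx hy a ha => by
        rw [add_smul]; exact (K n).add_mem (hx a ha) (hy a ha)
      smul_mem' := fun c x hx a ha => by
        rw [smul_assoc]; exact (K n).smul_mem c (hx a ha) }
  have hbmem : ∀ n x, x ∈ b n ↔ ∀ a ∈ K (n + 1), x • a ∈ K n := fun n x => Iff.rfl
  have hbmono : Monotone b := by
    refine monotone_nat_of_le_succ fun n x hx a ha => ?_
    rw [← hFK, hF]
    rw [← hFK] at ha
    obtain ⟨q, rfl⟩ : ∃ q, p = q + 1 := ⟨p - 1, by omega⟩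
    rw [pow_succ, mul_smul]
    exact (K n).smul_mem _ (hx _ ha)
  -- stabilization of `b`
  obtain ⟨n, hn⟩ : ∃ n, ∀ m, n ≤ m → b n = b m := by
    obtain ⟨E, e0, hE, he0, hm, hsoc⟩ := exists_injHull T
    have hN := dual_isNoetherian hfg hE e0 hm hsoc A
    have hRN : IsNoetherianRing (T ⧸ Module.annihilator T (A →ₗ[T] E)) := noeth_quot_ann
    have hJ : ∀ n, Module.annihilator T (A →ₗ[T] E) ≤ b n := by
      intro n x hx a _
      have : x • a = 0 := by
        by_contra hne
        obtain ⟨f, -, hf⟩ := cogenerator hE e0 he0 hm (⊥ : Submodule T A) (x • a)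
          (by simpa using hne)
        apply hf
        rw [map_smul, ← LinearMap.smul_apply, Module.mem_annihilator.1 hx f]; rfl
      rw [this]; exact (K n).zero_mem
    obtain ⟨n, hn⟩ := monotone_stabilizes_iff_noetherian.2 hRN
      ⟨fun n => (b n).map (Ideal.Quotient.mk (Module.annihilator T (A →ₗ[T] E))),
        fun i j h => Ideal.map_mono (hbmono h)⟩
    refine ⟨n, fun m hm => ?_⟩
    have h1 := hn m hm
    change (b n).map (Ideal.Quotient.mk (Module.annihilator T (A →ₗ[T] E))) =
      (b m).map (Ideal.Quotient.mk (Module.annihilator T (A →ₗ[T] E))) at h1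
    rw [← Ideal.comap_map_mk (hJ n), ← Ideal.comap_map_mk (hJ m), h1]
  by_cases hbt : b n = ⊤
  · refine ⟨n, fun z hz => ?_⟩
    obtain ⟨m, hm⟩ := hz
    have key : ∀ j, K (n + j) ≤ K n := by
      intro j
      induction j with
      | zero => exact le_rfl
      | succ j ih =>
        intro a ha
        have h1 : (1 : T) ∈ b (n + j) := by
          rw [← hn (n + j) (Nat.le_add_right _ _), hbt]; trivial
        have h2 := h1 a ha
        rw [one_smul] at h2
        exact ih h2
    have h3 : z ∈ K (n + m) := hKmono (Nat.le_add_left m n) hm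
    exact key m h3
  · exfalso
    -- squares of elements of `b n` kill the nilpotent part modulo `K n`
    have hsq : ∀ x ∈ b n, ∀ j, ∀ a ∈ K (n + j), x ^ 2 • a ∈ K n := by
      intro x hx j
      induction j with
      | zero => intro a ha; exact (K n).smul_mem _ ha
      | succ j ih =>
        intro a ha
        have h1 := ih (F a) ((hFK _ _).2 ha)
        have h2 : x • a ∈ K (n + 1) := by
          rw [← hFK, hF]
          obtain ⟨q, rfl⟩ : ∃ q, p = q + 2 := ⟨p - 2, by omega⟩
          rw [pow_add, mul_smul]
          exact (K n).smul_mem _ h1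
        rw [pow_two, mul_smul]
        exact hx _ h2
    let N : Submodule T A := ⨆ j, K j
    have hKN : ∀ j, K j ≤ N := fun j => le_iSup K j
    have hNmem : ∀ a ∈ N, ∃ j, a ∈ K j := fun a ha =>
      (Submodule.mem_iSup_of_directed K hKmono.directed_le).1 ha
    let Z : Submodule T N := (K n).comap N.subtype
    have hZmem : ∀ a : N, Z.mkQ a = 0 ↔ (a : A) ∈ K n := fun a =>
      Submodule.Quotient.mk_eq_zero Z
    let K' : ℕ → Submodule T (N ⧸ Z) := fun e => ((K (n + e)).comap N.subtype).map Z.mkQ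
    have hK'mem : ∀ e (a : N), Z.mkQ a ∈ K' e ↔ (a : A) ∈ K (n + e) := by
      intro e a
      constructor
      · rintro ⟨c, hc, hca⟩
        have h1 : Z.mkQ (a - c) = 0 := by rw [map_sub, hca, sub_self]
        rw [hZmem] at h1
        have h2 := (K (n + e)).add_mem (hKmono (Nat.le_add_right n e) h1) hc
        simpa using h2
      · intro ha
        exact ⟨a, ha, rfl⟩
    have hK' : Monotone K' := fun i j hij =>
      Submodule.map_mono (Submodule.comap_mono (hKmono (Nat.add_le_add_left hij n)))
    have hnt : Nontrivial (N ⧸ Z) := by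
      have h1 : (1 : T) ∉ b n := fun h => hbt ((Ideal.eq_top_iff_one _).2 h)
      rw [hbmem] at h1
      push Not at h1
      obtain ⟨a, ha, hna⟩ := h1
      rw [one_smul] at hna
      refine ⟨Z.mkQ ⟨a, hKN _ ha⟩, 0, fun h => hna ((hZmem _).1 h)⟩
    obtain ⟨e, s, hsb, hs⟩ := chain_lemma hfg (N ⧸ Z) K' hK' (b n) (by
      intro x hx a
      obtain ⟨a, rfl⟩ := Z.mkQ_surjective a
      rw [← map_smul, hZmem]
      obtain ⟨j, hj⟩ := hNmem a a.2
      exact hsq x hx j a (hKmono (Nat.le_add_left j n) hj))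
    apply hsb
    rw [hn (n + e) (Nat.le_add_right _ _)]
    intro a ha
    have h1 := hs (Z.mkQ ⟨a, hKN _ ha⟩) ((hK'mem (e + 1) ⟨a, hKN _ ha⟩).2 ha)
    rw [← map_smul, hK'mem] at h1
    exact h1

theorem evalA_factor {R : Type*} [CommRing R] (I : Ideal R) {m n : ℕ} (h : m ≤ n)
    (t : AdicCompletion I R) (r : R)
    (hr : Ideal.Quotient.mk (I ^ n) r = AdicCompletion.evalₐ I n t) :
    Ideal.Quotient.mk (I ^ m) r = AdicCompletion.evalₐ I m t := by
  obtain ⟨x, rfl⟩ := AdicCompletion.mk_surjective I R t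
  rw [AdicCompletion.evalₐ_mk] at hr ⊢
  rw [Ideal.Quotient.eq] at hr ⊢
  have h1 := Ideal.pow_le_pow_right h hr
  have h2 := x.2 h
  rw [SModEq.sub_mem] at h2
  have h3 : x.val m - x.val n ∈ I ^ m := by simpa using h2
  have := (I ^ m).sub_mem h1 h3
  convert this using 1
  ring

section completionAction

variable {R : Type*} [CommRing R] (I : Ideal R) {A : Type*} [AddCommGroup A] [Module R A]

/-- The value of the action of a completion element on a torsion element. -/
noncomputable def complSmul (htor : ∀ a : A, ∃ n : ℕ, ∀ x ∈ I ^ n, x • a = 0)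
    (t : AdicCompletion I R) (a : A) : A :=
  (Ideal.Quotient.mk_surjective (AdicCompletion.evalₐ I (htor a).choose t)).choose • a

theorem complSmul_eq (htor : ∀ a : A, ∃ n : ℕ, ∀ x ∈ I ^ n, x • a = 0)
    (t : AdicCompletion I R) (a : A) (n : ℕ) (hn : ∀ x ∈ I ^ n, x • a = 0) (r : R)
    (hr : Ideal.Quotient.mk (I ^ n) r = AdicCompletion.evalₐ I n t) :
    complSmul I htor t a = r • a := by
  have key : ∀ (m : ℕ) (_ : ∀ x ∈ I ^ m, x • a = 0) (s : R)
      (_ : Ideal.Quotient.mk (I ^ m) s = AdicCompletion.evalₐ I m t), s • a = r • a := by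
    intro m hm s hs
    rw [← sub_eq_zero, ← sub_smul]
    rcases le_total m n with h | h
    · have := evalA_factor I h t r hr
      rw [← hs, eq_comm, Ideal.Quotient.eq] at this
      exact hm _ this
    · have := evalA_factor I h t s hs
      rw [← hr, Ideal.Quotient.eq] at this
      exact hn _ this
  exact key _ (htor a).choose_spec _
    (Ideal.Quotient.mk_surjective (AdicCompletion.evalₐ I (htor a).choose t)).choose_spec

/-- The module structure over the completion on a torsion module. -/
noncomputable def complModule (htor : ∀ a : A, ∃ n : ℕ, ∀ x ∈ I ^ n, x • a = 0) :
    Module (AdicCompletion I R) A where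
  smul t a := complSmul I htor t a
  one_smul a := by
    obtain ⟨n, hn⟩ := htor a
    exact (complSmul_eq I htor 1 a n hn 1 (by simp)).trans (one_smul _ _)
  mul_smul t u a := by
    obtain ⟨n, hn⟩ := htor a
    obtain ⟨r, hr⟩ := Ideal.Quotient.mk_surjective (AdicCompletion.evalₐ I n t)
    obtain ⟨s, hs⟩ := Ideal.Quotient.mk_surjective (AdicCompletion.evalₐ I n u)
    change complSmul I htor (t * u) a = complSmul I htor t (complSmul I htor u a)
    rw [complSmul_eq I htor (t * u) a n hn (r * s) (by rw [map_mul, map_mul, hr, hs]),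
      complSmul_eq I htor u a n hn s hs,
      complSmul_eq I htor t (s • a) n (fun x hx => by rw [smul_comm, hn x hx, smul_zero]) r hr,
      mul_smul]
  smul_zero t := by
    obtain ⟨r, hr⟩ := Ideal.Quotient.mk_surjective (AdicCompletion.evalₐ I 0 t)
    exact (complSmul_eq I htor t 0 0 (fun x _ => smul_zero x) r hr).trans (smul_zero _)
  smul_add t a b := by
    obtain ⟨n, hn⟩ := htor a
    obtain ⟨m, hm⟩ := htor b
    have hn' : ∀ x ∈ I ^ (max n m), x • a = 0 := fun x hx =>
      hn x (Ideal.pow_le_pow_right (le_max_left _ _) hx)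
    have hm' : ∀ x ∈ I ^ (max n m), x • b = 0 := fun x hx =>
      hm x (Ideal.pow_le_pow_right (le_max_right _ _) hx)
    obtain ⟨r, hr⟩ := Ideal.Quotient.mk_surjective (AdicCompletion.evalₐ I (max n m) t)
    change complSmul I htor t (a + b) = complSmul I htor t a + complSmul I htor t b
    rw [complSmul_eq I htor t a _ hn' r hr, complSmul_eq I htor t b _ hm' r hr,
      complSmul_eq I htor t (a + b) _
        (fun x hx => by rw [smul_add, hn' x hx, hm' x hx, add_zero]) r hr, smul_add]
  add_smul t u a := by
    obtain ⟨n, hn⟩ := htor a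
    obtain ⟨r, hr⟩ := Ideal.Quotient.mk_surjective (AdicCompletion.evalₐ I n t)
    obtain ⟨s, hs⟩ := Ideal.Quotient.mk_surjective (AdicCompletion.evalₐ I n u)
    change complSmul I htor (t + u) a = complSmul I htor t a + complSmul I htor u a
    rw [complSmul_eq I htor (t + u) a n hn (r + s) (by rw [map_add, map_add, hr, hs]),
      complSmul_eq I htor u a n hn s hs, complSmul_eq I htor t a n hn r hr, add_smul]
  zero_smul a := by
    obtain ⟨n, hn⟩ := htor a
    exact (complSmul_eq I htor 0 a n hn 0 (by simp)).trans (zero_smul _ _)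

end completionAction

/-- Hartshorne–Speiser–Lyubeznik: for an Artinian module `A` over a
Noetherian local ring of prime characteristic `p` with a Frobenius action `F`
(additive, `F (r • a) = r^p • F a`), there is `e ≥ 0` such that the nilpotent part
`0^F_A = {z | F^n z = 0 for some n}` equals `ker (F^e)`. -/
theorem exists_HSL_number
    {R : Type*} [CommRing R] [IsNoetherianRing R] [IsLocalRing R]
    (p : ℕ) [Fact p.Prime] [CharP R p]
    (A : Type*) [AddCommGroup A] [Module R A] [IsArtinian R A]
    (F : AddMonoid.End A) (hF : ∀ (r : R) (a : A), F (r • a) = r ^ p • F a) :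
    ∃ e : ℕ, {z : A | ∃ n : ℕ, (F ^ n) z = 0} = {z : A | (F ^ e) z = 0} := by
  have hfgR : (maximalIdeal R).FG := Ideal.fg_of_isNoetherianRing _
  have htor : ∀ a : A, ∃ n : ℕ, ∀ x ∈ maximalIdeal R ^ n, x • a = 0 :=
    fun a => torsion_of_artinian hfgR a
  let T := AdicCompletion (maximalIdeal R) R
  let _ : Module T A := complModule (maximalIdeal R) htor
  have hsm : ∀ (t : T) (a : A), t • a = complSmul (maximalIdeal R) htor t a := fun _ _ => rfl
  have htower : IsScalarTower R T A := by
    refine ⟨fun r t a => ?_⟩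
    obtain ⟨n, hn⟩ := htor a
    obtain ⟨s, hs⟩ := Ideal.Quotient.mk_surjective (AdicCompletion.evalₐ (maximalIdeal R) n t)
    rw [hsm, hsm, complSmul_eq _ htor t a n hn s hs,
      complSmul_eq _ htor (r • t) a n hn (r * s) (by
        rw [map_smul, ← hs, Algebra.smul_def, map_mul]; rfl), mul_smul]
  have hart : IsArtinian T A := isArtinian_of_tower R inferInstance
  have hfgT : (maximalIdeal T).FG := by
    have h : maximalIdeal T = (maximalIdeal R).map (algebraMap R T) :=
      AdicCompletion.maximalIdeal_eq_map
    rw [h]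
    exact Ideal.FG.map hfgR _
  have hFT : ∀ (t : T) (a : A), F (t • a) = t ^ p • F a := by
    intro t a
    obtain ⟨n, hn⟩ := htor a
    obtain ⟨m, hm⟩ := htor (F a)
    have hn' : ∀ x ∈ maximalIdeal R ^ (max n m), x • a = 0 := fun x hx =>
      hn x (Ideal.pow_le_pow_right (le_max_left _ _) hx)
    have hm' : ∀ x ∈ maximalIdeal R ^ (max n m), x • F a = 0 := fun x hx =>
      hm x (Ideal.pow_le_pow_right (le_max_right _ _) hx)
    obtain ⟨r, hr⟩ := Ideal.Quotient.mk_surjective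
      (AdicCompletion.evalₐ (maximalIdeal R) (max n m) t)
    rw [hsm, hsm, complSmul_eq _ htor t a _ hn' r hr,
      complSmul_eq _ htor (t ^ p) (F a) _ hm' (r ^ p) (by rw [map_pow, map_pow, hr]), hF]
  have hprec : IsPrecomplete (maximalIdeal T) T :=
    (inferInstance : IsAdicComplete (maximalIdeal T) T).toIsPrecomplete
  obtain ⟨e, he⟩ := hsl_complete hfgT p (Fact.out : p.Prime).two_le A F hFT
  refine ⟨e, Set.ext fun z => ⟨fun hz => he z hz, fun hz => ⟨e, hz⟩⟩⟩
end

section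
/- Let (R,𝔪) be a Noetherian local ring and M a finitely generated R-module of finiteness dimension t > 0, and let n_0 ≥ 1 satisfy 𝔪^{n_0} H^i_𝔪(M) = 0 for all i < t. For any filter regular element x ∈ 𝔪^{2n_0} on M, there are isomorphisms H^i_𝔪(M/xM) ≅ H^i_𝔪(M) ⊕ H^{i+1}_𝔪(M) for all i < t − 1. -/
universe u

open IsLocalRing

/-- The `i`-th local cohomology module `H^i_J(M)`. -/
noncomputable def lcoh {R : Type u} [CommRing R] (J : Ideal R) (i : ℕ)
    (M : Type u) [AddCommGroup M] [Module R M] : ModuleCat.{u} R :=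
  (localCohomology J i).obj (ModuleCat.of R M)

section partA
open CategoryTheory Limits Opposite

lemma equivOfSurj {R W V V' : Type*} [CommRing R] [AddCommGroup W] [Module R W]
    [AddCommGroup V] [Module R V] [AddCommGroup V'] [Module R V']
    (f : W →ₗ[R] V) (g : W →ₗ[R] V') (hf : Function.Surjective f) (hg : Function.Surjective g)
    (h : ∀ w, f w = 0 ↔ g w = 0) : Nonempty (V ≃ₗ[R] V') := by
  have hk : LinearMap.ker f = LinearMap.ker g := by
    ext w; simpa using h w
  exact ⟨(f.quotKerEquivOfSurjective hf).symm.trans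
    ((Submodule.quotEquivOfEq _ _ hk).trans (g.quotKerEquivOfSurjective hg))⟩

variable {R : Type u} [CommRing R]

lemma op_cyc (K : ChainComplex (ModuleCat.{u} R)ᵒᵖ ℕ) (i : ℕ) :
    Function.Injective (K.pOpcycles i).unop.hom ∧
    (∀ y, (K.d (i+1) i).unop.hom y = 0 ↔ ∃ o, (K.pOpcycles i).unop.hom o = y) := by
  refine ⟨?_, ?_⟩
  · rw [← ModuleCat.mono_iff_injective]; infer_instance
  · have hc := K.opcyclesIsCokernel (i+1) i (by simp)
    have he := (ShortComplex.exact_of_g_is_cokernel (ShortComplex.mk (K.d (i+1) i) (K.pOpcycles i) (by simp)) hc).unop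
    intro y
    have := (ShortComplex.ShortExact.moduleCat_exact_iff_function_exact _).1 he y
    exact this

lemma op_hom (K : ChainComplex (ModuleCat.{u} R)ᵒᵖ ℕ) (i : ℕ) :
    Function.Surjective (K.homologyι i).unop.hom ∧
    (∀ o, (K.homologyι i).unop.hom o = 0 ↔
      ∃ w, (K.d i (i-1)).unop.hom w = (K.pOpcycles i).unop.hom o) := by
  refine ⟨?_, ?_⟩
  · rw [← ModuleCat.epi_iff_surjective]; infer_instance
  · have hc := K.homologyIsKernel i (i-1) (by cases i <;> simp)
    have he := (ShortComplex.exact_of_f_is_kernel (ShortComplex.mk (K.homologyι i) (K.fromOpcycles i (i-1)) (by simp)) hc).unop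
    intro o
    have := (ShortComplex.ShortExact.moduleCat_exact_iff_function_exact _).1 he o
    refine this.trans ?_
    have hd : ∀ w, (K.d i (i-1)).unop.hom w = (K.pOpcycles i).unop.hom ((K.fromOpcycles i (i-1)).unop.hom w) := by
      intro w
      rw [← K.p_fromOpcycles i (i-1)]
      rfl
    constructor
    · rintro ⟨w, hw⟩
      exact ⟨w, (hd w).trans (congrArg _ hw)⟩
    · rintro ⟨w, hw⟩
      refine ⟨w, (op_cyc K i).1 ?_⟩
      exact (hd w).symm.trans hw

noncomputable section
namespace LC

variable (J : Ideal R)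

/-- the quotient modules -/
abbrev Qn (n : ℕ) : ModuleCat.{u} R := ModuleCat.of R (R ⧸ J ^ n)

/-- the transition maps -/
def qmap {n n' : ℕ} (h : n ≤ n') : Qn J n' ⟶ Qn J n :=
  (localCohomology.ringModIdeals (localCohomology.idealPowersDiagram J)).map (homOfLE h).op

/-- resolutions -/
def res (n : ℕ) : ProjectiveResolution (Qn J n) := projectiveResolution _

/-- system of resolutions -/
def sys : ℕᵒᵖ ⥤ ChainComplex (ModuleCat.{u} R) ℕ :=
  Functor.ofOpSequence (X := fun n => (res J n).complex)
    (fun n => ProjectiveResolution.lift (qmap J (Nat.le_add_right n 1)) (res J (n+1)) (res J n))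

def tau {n n' : ℕ} (h : n ≤ n') : (res J n').complex ⟶ (res J n).complex :=
  (sys J).map (homOfLE h).op

lemma tau_succ (n : ℕ) : tau J (Nat.le_add_right n 1) =
    ProjectiveResolution.lift (qmap J (Nat.le_add_right n 1)) (res J (n+1)) (res J n) :=
  Functor.ofOpSequence_map_homOfLE_succ _ n

lemma tau_refl (n : ℕ) : tau J (le_refl n) = 𝟙 _ := (sys J).map_id _

lemma tau_trans {a b c : ℕ} (h : a ≤ b) (h' : b ≤ c) :
    tau J (h.trans h') = tau J h' ≫ tau J h := by
  exact (sys J).map_comp (homOfLE h').op (homOfLE h).op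

lemma qmap_trans {a b c : ℕ} (h : a ≤ b) (h' : b ≤ c) :
    qmap J (h.trans h') = qmap J h' ≫ qmap J h := by
  exact (localCohomology.ringModIdeals (localCohomology.idealPowersDiagram J)).map_comp
    (homOfLE h').op (homOfLE h).op

lemma qmap_refl (n : ℕ) : qmap J (le_refl n) = 𝟙 _ := 
  (localCohomology.ringModIdeals (localCohomology.idealPowersDiagram J)).map_id _

/-- augmentation -/
def aug (n : ℕ) : (res J n).complex.X 0 ⟶ Qn J n := (res J n).π.f 0

lemma tau_aug {n n' : ℕ} (h : n ≤ n') :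
    (tau J h).f 0 ≫ aug J n = aug J n' ≫ qmap J h := by
  induction n', h using Nat.le_induction with
  | base => rw [tau_refl, qmap_refl]; simp
  | succ m h ih =>
    rw [tau_trans J h (Nat.le_add_right m 1), qmap_trans J h (Nat.le_add_right m 1),
      HomologicalComplex.comp_f, Category.assoc, ih, tau_succ, ← Category.assoc, ← Category.assoc]
    congr 1
    exact ProjectiveResolution.lift_commutes_zero _ _ _

/-- The functor -/
abbrev FN (N : ModuleCat.{u} R) := ((linearYoneda R (ModuleCat.{u} R)).obj N).rightOp

abbrev KN (n : ℕ) (N : ModuleCat.{u} R) : ChainComplex (ModuleCat.{u} R)ᵒᵖ ℕ :=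
  ((FN N).mapHomologicalComplex _).obj (res J n).complex

abbrev ExtN (i n : ℕ) (N : ModuleCat.{u} R) : ModuleCat.{u} R :=
  ((Ext R (ModuleCat.{u} R) i).obj (op (Qn J n))).obj N

/-- map from opcycles to Ext -/
def toExt (i n : ℕ) (N : ModuleCat.{u} R) : (unop ((KN J n N).opcycles i)) ⟶ ExtN J i n N :=
  ((KN J n N).homologyι i).unop ≫ ((res J n).isoLeftDerivedObj (FN N) i).hom.unop

lemma toExt_nat (i : ℕ) {n n' : ℕ} (h : n ≤ n') (N : ModuleCat.{u} R) :
    toExt J i n N ≫ ((Ext R (ModuleCat.{u} R) i).map (qmap J h).op).app N =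
     (HomologicalComplex.opcyclesMap (((FN N).mapHomologicalComplex _).map (tau J h)) i).unop ≫ toExt J i n' N := by
  have := ProjectiveResolution.isoLeftDerivedObj_hom_naturality (qmap J h) (res J n') (res J n)
    (tau J h) (tau_aug J h) (FN N) i
  have h2 := HomologicalComplex.homologyι_naturality (((FN N).mapHomologicalComplex _).map (tau J h)) i
  have h3 : ((FN N).leftDerived i).map (qmap J h) ≫ ((res J n).isoLeftDerivedObj (FN N) i).hom ≫
      HomologicalComplex.homologyι (((FN N).mapHomologicalComplex (ComplexShape.down ℕ)).obj
        (res J n).complex) i =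
      (((res J n').isoLeftDerivedObj (FN N) i).hom ≫ HomologicalComplex.homologyι
        (((FN N).mapHomologicalComplex (ComplexShape.down ℕ)).obj (res J n').complex) i) ≫
      HomologicalComplex.opcyclesMap (((FN N).mapHomologicalComplex _).map (tau J h)) i := by
    refine (Category.assoc _ _ _).symm.trans ?_
    refine (congrArg (· ≫ _) this).trans ?_
    refine (Category.assoc _ _ _).trans ?_
    refine Eq.trans ?_ (Category.assoc _ _ _).symm
    exact congrArg (_ ≫ ·) h2
  exact congrArg Quiver.Hom.unop h3

lemma toExt_elt (i n : ℕ) (N : ModuleCat.{u} R) :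
    Function.Surjective (toExt J i n N).hom ∧
    (∀ o, (toExt J i n N).hom o = 0 ↔ ∃ w : (res J n).complex.X (i-1) ⟶ N,
      (res J n).complex.d i (i-1) ≫ w = ((KN J n N).pOpcycles i).unop.hom o) := by
  have h := op_hom (KN J n N) i
  have hb : Function.Bijective ((res J n).isoLeftDerivedObj (FN N) i).hom.unop.hom := by
    exact ConcreteCategory.bijective_of_isIso ((res J n).isoLeftDerivedObj (FN N) i).hom.unop
  refine ⟨hb.2.comp h.1, fun o => ?_⟩
  refine Iff.trans ?_ (h.2 o)
  change ((res J n).isoLeftDerivedObj (FN N) i).hom.unop.hom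
    (((KN J n N).homologyι i).unop.hom o) = 0 ↔ _
  exact map_eq_zero_iff _ hb.1

lemma pop_elt (i n : ℕ) (N : ModuleCat.{u} R) :
    (∀ y : (res J n).complex.X i ⟶ N, (res J n).complex.d (i+1) i ≫ y = 0 ↔
      ∃ o, ((KN J n N).pOpcycles i).unop.hom o = y) :=
  (op_cyc (KN J n N) i).2

lemma pop_nat (i : ℕ) {n n' : ℕ} (h : n ≤ n') (N : ModuleCat.{u} R)
    (o : (unop ((KN J n N).opcycles i) : ModuleCat.{u} R)) :
    ((KN J n' N).pOpcycles i).unop.hom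
      ((HomologicalComplex.opcyclesMap (((FN N).mapHomologicalComplex _).map (tau J h)) i).unop.hom o)
    = (tau J h).f i ≫ (((KN J n N).pOpcycles i).unop.hom o : (res J n).complex.X i ⟶ N) := by
  have := HomologicalComplex.p_opcyclesMap (((FN N).mapHomologicalComplex _).map (tau J h)) i
  have h2 := congrArg Quiver.Hom.unop this
  exact congrArg (fun f => (ModuleCat.Hom.hom f) o) h2

/-- diagram -/
abbrev Dg (i : ℕ) : ℕᵒᵖᵒᵖ ⥤ ModuleCat.{u} R ⥤ ModuleCat.{u} R :=
  localCohomology.diagram (localCohomology.idealPowersDiagram J) i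

variable (N : Type u) [AddCommGroup N] [Module R N]

def inc (i n : ℕ) : ExtN J i n (ModuleCat.of R N) ⟶ lcoh J i N :=
  (colimit.ι (Dg J i) (op (op n))).app (ModuleCat.of R N)

def isCol (i : ℕ) := isColimitOfPreserves ((evaluation _ _).obj (ModuleCat.of R N))
  (colimit.isColimit (Dg J i))

instance presFil : PreservesFilteredColimitsOfSize.{0, 0} (forget (ModuleCat.{u} R)) :=
  preservesFilteredColimitsOfSize_shrink.{0, u, 0, u} _

instance (i : ℕ) : PreservesColimit (Dg J i ⋙ (evaluation (ModuleCat.{u} R) (ModuleCat.{u} R)).obj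
    (ModuleCat.of R N)) (forget (ModuleCat.{u} R)) :=
  haveI := PreservesFilteredColimitsOfSize.preserves_filtered_colimits
    (F := forget (ModuleCat.{u} R)) ℕᵒᵖᵒᵖ
  inferInstance

lemma inc_surj (i : ℕ) (a : lcoh J i N) : ∃ n e, (inc J N i n).hom e = a := by
  obtain ⟨j, y, hy⟩ := Concrete.isColimit_exists_rep _ (isCol J N i) a
  exact ⟨j.unop.unop, y, hy⟩

lemma inc_nat (i : ℕ) {n n' : ℕ} (h : n ≤ n') (e) :
    (inc J N i n').hom ((((Ext R (ModuleCat.{u} R) i).map (qmap J h).op).app (.of R N)).hom e)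
      = (inc J N i n).hom e := by
  have := colimit.w (Dg J i) ((homOfLE h).op.op : op (op n) ⟶ op (op n'))
  have h2 := congrArg (fun f => (f.app (.of R N)).hom e) this
  exact h2

lemma inc_zero (i n : ℕ) (e) (he : (inc J N i n).hom e = 0) : ∃ n', ∃ h : n ≤ n', 
    (((Ext R (ModuleCat.{u} R) i).map (qmap J h).op).app (.of R N)).hom e = 0 := by
  have := Concrete.isColimit_exists_of_rep_eq _ (isCol J N i) (i := op (op n)) (j := op (op n)) e 0
    (he.trans (map_zero (inc J N i n).hom).symm)
  obtain ⟨k, f, g, hfg⟩ := this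
  refine ⟨k.unop.unop, leOfHom f.unop.unop, ?_⟩
  refine Eq.trans ?_ (hfg.trans ?_)
  · rfl
  · exact map_zero ((((Dg J i) ⋙ (evaluation _ _).obj (ModuleCat.of R N)).map g).hom)

/-- Graph of the cocycle to lcoh -/
def Gam (i n : ℕ) : Submodule R (((res J n).complex.X i →ₗ[R] N) × lcoh J i N) where
  carrier := {p | ∃ o : (unop ((KN J n (.of R N)).opcycles i) : ModuleCat.{u} R),
    ((KN J n (.of R N)).pOpcycles i).unop.hom o = ModuleCat.ofHom p.1 ∧
    (inc J N i n).hom ((toExt J i n (.of R N)).hom o) = p.2}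
  add_mem' := by
    rintro a b ⟨o, h1, h2⟩ ⟨o', h1', h2'⟩
    refine ⟨o + o', ?_, ?_⟩
    · rw [map_add, h1, h1']; rfl
    · rw [map_add, map_add, h2, h2']; rfl
  zero_mem' := ⟨0, by rw [map_zero]; rfl, by rw [map_zero, map_zero]; rfl⟩
  smul_mem' := by
    rintro r a ⟨o, h1, h2⟩
    refine ⟨r • o, ?_, ?_⟩
    · rw [map_smul, h1]; rfl
    · rw [map_smul, map_smul, h2]; rfl

/-- differential -/
def dd (n i j : ℕ) : (res J n).complex.X i →ₗ[R] (res J n).complex.X j :=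
  ((res J n).complex.d i j).hom

def tt {n n' : ℕ} (h : n ≤ n') (i : ℕ) : (res J n').complex.X i →ₗ[R] (res J n).complex.X i :=
  ((tau J h).f i).hom

variable {N}
variable {J}
lemma Gam_a {i n : ℕ} {p} (hp : p ∈ Gam J N i n) : p.1 ∘ₗ dd J n (i+1) i = 0 := by
  obtain ⟨o, h1, h2⟩ := hp
  have := (pop_elt J i n (.of R N) (ModuleCat.ofHom p.1)).2 ⟨o, h1⟩
  exact congrArg ModuleCat.Hom.hom this

lemma Gam_b {i n : ℕ} (φ : (res J n).complex.X i →ₗ[R] N) (hp : φ ∘ₗ dd J n (i+1) i = 0) :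
    ∃ a, (φ, a) ∈ Gam J N i n := by
  obtain ⟨o, ho⟩ := (pop_elt J i n (.of R N) (ModuleCat.ofHom φ)).1 (ModuleCat.hom_ext hp)
  exact ⟨_, o, ho, rfl⟩

lemma Gam_c (i : ℕ) (a : lcoh J i N) : ∃ n φ, (φ, a) ∈ Gam J N i n := by
  obtain ⟨n, e, rfl⟩ := inc_surj J N i a
  obtain ⟨o, rfl⟩ := (toExt_elt J i n (.of R N)).1 e
  exact ⟨n, ModuleCat.Hom.hom (((KN J n (.of R N)).pOpcycles i).unop.hom o : (res J n).complex.X i ⟶ .of R N), o, rfl, rfl⟩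

lemma Gam_d {i n n' : ℕ} (h : n ≤ n') {φ a} (hp : (φ, a) ∈ Gam J N i n) :
    (φ ∘ₗ tt J h i, a) ∈ Gam J N i n' := by
  obtain ⟨o, h1, h2⟩ := hp
  refine ⟨_, (pop_nat J i h (.of R N) o).trans ?_, ?_⟩
  · rw [h1]; rfl
  · refine Eq.trans ?_ h2
    have := congrArg (fun f => (ModuleCat.Hom.hom f) o) (toExt_nat J i h (.of R N))
    refine Eq.trans ?_ (inc_nat J N i h _)
    exact congrArg _ this.symm

lemma Gam_e {i n : ℕ} {φ a} (hp : (φ, a) ∈ Gam J N i n) :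
    a = 0 ↔ ∃ n', ∃ h : n ≤ n', ∃ ψ : (res J n').complex.X (i-1) →ₗ[R] N,
      ψ ∘ₗ dd J n' i (i-1) = φ ∘ₗ tt J h i := by
  constructor
  · rintro rfl
    obtain ⟨o, h1, h2⟩ := hp
    obtain ⟨n', h, h3⟩ := inc_zero J N i n _ h2
    have := congrArg (fun f => (ModuleCat.Hom.hom f) o) (toExt_nat J i h (.of R N))
    obtain ⟨w, hw⟩ := ((toExt_elt J i n' (.of R N)).2 _).1 (this.symm.trans h3)
    refine ⟨n', h, w.hom, ?_⟩
    have h4 := pop_nat J i h (.of R N) o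
    rw [h1] at h4
    exact congrArg ModuleCat.Hom.hom (hw.trans h4)
  · rintro ⟨n', h, ψ, hψ⟩
    obtain ⟨o, h1, h2⟩ := Gam_d h hp
    refine h2.symm.trans ?_
    have := ((toExt_elt J i n' (.of R N)).2 o).2 ⟨ModuleCat.ofHom ψ, ?_⟩
    · rw [this, map_zero]
    · rw [h1]
      exact ModuleCat.hom_ext hψ

end LC
end
end partA

section partb
open CategoryTheory Limits Opposite

noncomputable section
namespace LC
variable {R : Type u} [CommRing R] (J : Ideal R)

/-- terms -/
abbrev X (n i : ℕ) : Type u := (res J n).complex.X i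

instance proj_X (n i : ℕ) : Module.Projective R (X J n i) := by
  have := (res J n).projective i
  exact (IsProjective.iff_projective (R := R) (X J n i)).2 this

lemma dd_exact (n i : ℕ) (y : X J n (i+1)) (hy : dd J n (i+1) i y = 0) :
    ∃ w, dd J n (i+2) (i+1) w = y := by
  have := (ShortComplex.ShortExact.moduleCat_exact_iff_function_exact _).1 ((res J n).exact_succ i)
  exact (this y).1 hy

lemma dd_dd (n i j k : ℕ) (y : X J n i) : dd J n j k (dd J n i j y) = 0 := by
  have := (res J n).complex.d_comp_d i j k
  exact congrArg (fun f => (ModuleCat.Hom.hom f) y) this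

lemma dd00 (n : ℕ) : dd J n 0 0 = 0 := by
  have := (res J n).complex.shape 0 0 (by simp)
  exact congrArg ModuleCat.Hom.hom this

lemma tt_dd {n n' : ℕ} (h : n ≤ n') (i j : ℕ) (y : X J n' i) :
    tt J h j (dd J n' i j y) = dd J n i j (tt J h i y) := by
  have := (tau J h).comm i j
  exact congrArg (fun f => (ModuleCat.Hom.hom f) y) this.symm

lemma tt_refl (n i : ℕ) (y : X J n i) : tt J (le_refl n) i y = y := by
  unfold tt; rw [tau_refl]; rfl

lemma tt_trans {a b c : ℕ} (h : a ≤ b) (h' : b ≤ c) (i : ℕ) (y : X J c i) :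
    tt J h i (tt J h' i y) = tt J (h.trans h') i y := by
  unfold tt; rw [tau_trans J h h']; rfl

/-- augmentation -/
def eps (n : ℕ) : X J n 0 →ₗ[R] R ⧸ J ^ n := (aug J n).hom

lemma eps_surj (n : ℕ) : Function.Surjective (eps J n) := by
  have : Epi (aug J n) := inferInstanceAs (Epi ((res J n).π.f 0))
  exact (ModuleCat.epi_iff_surjective _).1 this

lemma eps_exact (n : ℕ) (y : X J n 0) : eps J n y = 0 ↔ ∃ w, dd J n 1 0 w = y := by
  have := (ShortComplex.ShortExact.moduleCat_exact_iff_function_exact _).1 ((res J n).exact₀)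
  exact this y

lemma eps_tt {n n' : ℕ} (h : n ≤ n') (y : X J n' 0) :
    eps J n (tt J h 0 y) = Ideal.Quotient.factor (Ideal.pow_le_pow_right h) (eps J n' y) := by
  have := congrArg (fun f => (ModuleCat.Hom.hom f) y) (tau_aug J h)
  refine Eq.trans this ?_
  change (qmap J h).hom (eps J n' y) = _
  obtain ⟨r, hr⟩ := Ideal.Quotient.mk_surjective (eps J n' y)
  rw [← hr]
  rfl

/-- cochains -/
def Cx (i : ℕ) (N : Type u) [AddCommGroup N] [Module R N] : Type u :=
  Module.DirectLimit (fun n : ℕ => (X J n i →ₗ[R] N)) (fun _ _ h => LinearMap.lcomp R N (tt J h i))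

variable (N N' N'' : Type u) [AddCommGroup N] [Module R N] [AddCommGroup N'] [Module R N']
  [AddCommGroup N''] [Module R N'']

instance (i : ℕ) : AddCommGroup (Cx J i N) := by unfold Cx; infer_instance
instance (i : ℕ) : Module R (Cx J i N) := by unfold Cx; infer_instance

instance dsys (i : ℕ) : DirectedSystem (fun n : ℕ => (X J n i →ₗ[R] N))
    (fun _ _ h => LinearMap.lcomp R N (tt J h i)) where
  map_self n φ := by ext y; simp [tt_refl]
  map_map a b c h h' φ := by ext y; simp [tt_trans]

variable {N N' N''}

def mk {i : ℕ} (n : ℕ) : (X J n i →ₗ[R] N) →ₗ[R] Cx J i N :=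
  Module.DirectLimit.of R ℕ _ (fun _ _ h => LinearMap.lcomp R N (tt J h i)) n

lemma mk_surj {i : ℕ} (c : Cx J i N) : ∃ n φ, mk J n φ = c :=
  Module.DirectLimit.exists_of c

lemma mk_of_zero {i n : ℕ} {φ : X J n i →ₗ[R] N} (h : φ = 0) : mk J n φ = 0 := by
  rw [h, map_zero]

lemma mk_tt {i n n' : ℕ} (h : n ≤ n') (φ : X J n i →ₗ[R] N) :
    mk J n' (φ ∘ₗ tt J h i) = mk J n φ :=
  Module.DirectLimit.of_f (f := (fun _ _ h => LinearMap.lcomp R N (tt J h i)))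

lemma mk_zero {i n : ℕ} (φ : X J n i →ₗ[R] N) (h : mk J n φ = 0) :
    ∃ n', ∃ h : n ≤ n', φ ∘ₗ tt J h i = 0 :=
  Module.DirectLimit.of.zero_exact h

def D (i j : ℕ) : Cx J i N →ₗ[R] Cx J j N :=
  Module.DirectLimit.map (fun n => LinearMap.lcomp R N (dd J n j i)) (by
    intro n n' h; ext φ y; simp [tt_dd])

lemma D_mk {i j n : ℕ} (φ : X J n i →ₗ[R] N) : D J i j (mk J n φ) = mk J n (φ ∘ₗ dd J n j i) :=
  Module.DirectLimit.map_apply_of ..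

def mapC0 (i : ℕ) (g : N →ₗ[R] N') : Cx J i N →ₗ[R] Cx J i N' :=
  Module.DirectLimit.map (fun n => LinearMap.llcomp R (X J n i) N N' g) (by
    intro n n' h; ext φ y; simp)

lemma mapC0_mk {i n : ℕ} (g : N →ₗ[R] N') (φ : X J n i →ₗ[R] N) :
    mapC0 J i g (mk J n φ) = mk J n (g ∘ₗ φ) :=
  Module.DirectLimit.map_apply_of ..

def mapC (i : ℕ) : (N →ₗ[R] N') →ₗ[R] (Cx J i N →ₗ[R] Cx J i N') where
  toFun := mapC0 J i
  map_add' g g' := by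
    ext c; obtain ⟨n, φ, rfl⟩ := mk_surj J c
    simp only [LinearMap.add_apply, mapC0_mk, ← map_add]
    congr 1
  map_smul' r g := by
    ext c; obtain ⟨n, φ, rfl⟩ := mk_surj J c
    simp only [LinearMap.smul_apply, mapC0_mk, ← map_smul, RingHom.id_apply]
    congr 1

lemma mapC_mk {i n : ℕ} (g : N →ₗ[R] N') (φ : X J n i →ₗ[R] N) :
    mapC J i g (mk J n φ) = mk J n (g ∘ₗ φ) := mapC0_mk J g φ

lemma mapC_comp {i : ℕ} (g : N →ₗ[R] N') (g' : N' →ₗ[R] N'') (c : Cx J i N) :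
    mapC J i (g' ∘ₗ g) c = mapC J i g' (mapC J i g c) := by
  obtain ⟨n, φ, rfl⟩ := mk_surj J c
  simp only [mapC_mk]; rfl

lemma mapC_id {i : ℕ} (c : Cx J i N) :
    mapC J i LinearMap.id c = c := by
  obtain ⟨n, φ, rfl⟩ := mk_surj J c
  simp only [mapC_mk]; rfl

lemma mapC_D {i j : ℕ} (g : N →ₗ[R] N') (c : Cx J i N) :
    mapC J j g (D J i j c) = D J i j (mapC J i g c) := by
  obtain ⟨n, φ, rfl⟩ := mk_surj J c
  simp only [mapC_mk, D_mk]; rfl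

lemma D_D {i j k : ℕ} (c : Cx J i N) : D J j k (D J i j c) = 0 := by
  obtain ⟨n, φ, rfl⟩ := mk_surj J c
  simp only [D_mk]
  apply mk_of_zero
  ext y; simp [dd_dd]

lemma D00 (c : Cx J 0 N) : D J 0 0 c = 0 := by
  obtain ⟨n, φ, rfl⟩ := mk_surj J c
  rw [D_mk, dd00, LinearMap.comp_zero, map_zero]

lemma mapC_inj {i : ℕ} (g : N →ₗ[R] N') (hg : Function.Injective g) :
    Function.Injective (mapC J i g) := by
  rw [injective_iff_map_eq_zero]
  intro c hc
  obtain ⟨n, φ, rfl⟩ := mk_surj J c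
  rw [mapC_mk] at hc
  obtain ⟨n', h, h0⟩ := mk_zero J _ hc
  rw [← mk_tt J h]
  apply mk_of_zero
  ext y
  apply hg
  simpa using LinearMap.congr_fun h0 y

lemma mapC_surj {i : ℕ} (g : N →ₗ[R] N') (hg : Function.Surjective g) :
    Function.Surjective (mapC J i g) := by
  intro c
  obtain ⟨n, φ, rfl⟩ := mk_surj J c
  obtain ⟨ψ, hψ⟩ := Module.projective_lifting_property g φ hg
  exact ⟨mk J n ψ, by rw [mapC_mk, hψ]⟩

lemma mapC_exact {i : ℕ} (f : N →ₗ[R] N') (g : N' →ₗ[R] N'') (hf : Function.Injective f)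
    (h : ∀ y, g y = 0 → ∃ x, f x = y) (c : Cx J i N') (hc : mapC J i g c = 0) :
    ∃ b, mapC J i f b = c := by
  obtain ⟨n, φ, rfl⟩ := mk_surj J c
  rw [mapC_mk] at hc
  obtain ⟨n', hn, h0⟩ := mk_zero J _ hc
  have hr : ∀ y, (φ ∘ₗ tt J hn i) y ∈ LinearMap.range f := fun y =>
    h _ (LinearMap.congr_fun h0 y)
  let e := LinearEquiv.ofInjective f hf
  refine ⟨mk J n' (e.symm.toLinearMap ∘ₗ (φ ∘ₗ tt J hn i).codRestrict _ hr), ?_⟩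
  rw [mapC_mk, ← mk_tt J hn φ]
  congr 1
  ext y
  have := congrArg Subtype.val (e.apply_symm_apply ((φ ∘ₗ tt J hn i).codRestrict _ hr y))
  exact this

lemma mapC_cx {i : ℕ} (f : N →ₗ[R] N') (g : N' →ₗ[R] N'') (h : ∀ x, g (f x) = 0) (c : Cx J i N) :
    mapC J i g (mapC J i f c) = 0 := by
  rw [← mapC_comp]
  have : g ∘ₗ f = 0 := LinearMap.ext h
  rw [this, map_zero]; rfl

lemma cocycle_rep {i : ℕ} (c : Cx J i N) (hc : D J i (i+1) c = 0) :
    ∃ n, ∃ φ : X J n i →ₗ[R] N, mk J n φ = c ∧ φ ∘ₗ dd J n (i+1) i = 0 := by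
  obtain ⟨n, φ, rfl⟩ := mk_surj J c
  rw [D_mk] at hc
  obtain ⟨n', h, h0⟩ := mk_zero J _ hc
  refine ⟨n', φ ∘ₗ tt J h i, mk_tt J h φ, ?_⟩
  ext y
  have := LinearMap.congr_fun h0 y
  simpa [tt_dd] using this

variable (N)
/-- cocycles -/
def Z (i : ℕ) : Submodule R (Cx J i N) := LinearMap.ker (D J i (i+1))
/-- coboundaries -/
def B (i : ℕ) : Submodule R (Cx J i N) := LinearMap.range (D J (i-1) i)
/-- cohomology -/
abbrev H (i : ℕ) := Z J N i ⧸ (B J N i).submoduleOf (Z J N i)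

/-- relation with lcoh -/
def Rel (i : ℕ) : Submodule R (Z J N i × lcoh J i N) where
  carrier := {p | ∃ n φ, mk J n φ = p.1 ∧ (φ, p.2) ∈ Gam J N i n}
  add_mem' := by
    rintro a b ⟨n, φ, h1, h2⟩ ⟨n', φ', h1', h2'⟩
    refine ⟨max n n', φ ∘ₗ tt J (le_max_left n n') i + φ' ∘ₗ tt J (le_max_right n n') i, ?_, ?_⟩
    · rw [map_add, mk_tt, mk_tt, h1, h1']; rfl
    · exact add_mem (Gam_d _ h2) (Gam_d _ h2')
  zero_mem' := ⟨0, 0, by simp, zero_mem _⟩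
  smul_mem' := by
    rintro r a ⟨n, φ, h1, h2⟩
    refine ⟨n, r • φ, ?_, Submodule.smul_mem _ r h2⟩
    rw [map_smul, h1]; rfl

lemma lcoh_equiv (i : ℕ) : Nonempty (H J N i ≃ₗ[R] lcoh J i N) := by
  refine equivOfSurj (W := Rel J N i)
    ((Submodule.mkQ _) ∘ₗ LinearMap.fst R _ _ ∘ₗ (Rel J N i).subtype)
    (LinearMap.snd R _ _ ∘ₗ (Rel J N i).subtype) ?_ ?_ ?_
  · intro q
    obtain ⟨⟨c, hc⟩, rfl⟩ := Submodule.mkQ_surjective _ q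
    obtain ⟨n, φ, rfl, hφ⟩ := cocycle_rep J c hc
    obtain ⟨a, ha⟩ := Gam_b φ hφ
    exact ⟨⟨(⟨_, hc⟩, a), n, φ, rfl, ha⟩, rfl⟩
  · intro a
    obtain ⟨n, φ, h⟩ := Gam_c i a
    refine ⟨⟨(⟨mk J n φ, ?_⟩, a), n, φ, rfl, h⟩, rfl⟩
    change D J i (i+1) _ = 0
    rw [D_mk, Gam_a h, map_zero]
  · rintro ⟨⟨⟨c, hc⟩, a⟩, n, φ, h1, h2⟩
    dsimp only at h1 h2
    change Submodule.mkQ _ (⟨c, hc⟩ : Z J N i) = 0 ↔ a = 0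
    rw [Gam_e h2, Submodule.mkQ_apply, Submodule.Quotient.mk_eq_zero]
    change (∃ b, D J (i-1) i b = c) ↔ _
    constructor
    · rintro ⟨b, hb⟩
      obtain ⟨m, ψ, rfl⟩ := mk_surj J b
      rw [D_mk, ← h1, ← mk_tt J (le_max_left m n), ← mk_tt J (le_max_right m n) φ,
        ← sub_eq_zero, ← map_sub] at hb
      obtain ⟨k, h, h0⟩ := mk_zero J _ hb
      refine ⟨k, (le_max_right m n).trans h, ψ ∘ₗ tt J ((le_max_left m n).trans h) (i-1), ?_⟩
      ext y
      have := LinearMap.congr_fun h0 y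
      simp only [LinearMap.comp_apply, LinearMap.sub_apply, tt_trans, LinearMap.zero_apply,
        sub_eq_zero] at this
      simp only [LinearMap.comp_apply, ← this, tt_dd]
    · rintro ⟨m, h, ψ, hψ⟩
      refine ⟨mk J m ψ, ?_⟩
      rw [D_mk, hψ, mk_tt, h1]

end LC
end
end partb

section partc
open CategoryTheory Limits Opposite

noncomputable section
namespace LC
variable {R : Type u} [CommRing R] (J : Ideal R)
variable {N N' N'' : Type u} [AddCommGroup N] [Module R N] [AddCommGroup N'] [Module R N']
  [AddCommGroup N''] [Module R N'']

lemma mem_Z {i : ℕ} {c : Cx J i N} : c ∈ Z J N i ↔ D J i (i+1) c = 0 := Iff.rfl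
lemma mem_B {i : ℕ} {c : Cx J i N} : c ∈ B J N i ↔ ∃ b, D J (i-1) i b = c := Iff.rfl

lemma mapC_Z {i : ℕ} (g : N →ₗ[R] N') {c : Cx J i N} (hc : c ∈ Z J N i) :
    mapC J i g c ∈ Z J N' i := by
  rw [mem_Z] at *; rw [← mapC_D, hc, map_zero]

lemma mapC_B {i : ℕ} (g : N →ₗ[R] N') {c : Cx J i N} (hc : c ∈ B J N i) :
    mapC J i g c ∈ B J N' i := by
  obtain ⟨b, rfl⟩ := hc
  exact ⟨mapC J _ g b, (mapC_D J g b).symm⟩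

/-- torsion -/
def Tors (N : Type u) [AddCommGroup N] [Module R N] : Prop :=
  ∀ v : N, ∃ n : ℕ, ∀ r ∈ J ^ n, r • v = 0

/-- vanishing of positive cohomology of injectives -/
lemma inj_vanish (E : Type u) [AddCommGroup E] [Module R E] [Module.Injective R E] {j : ℕ}
    (z : Cx J (j+1) E) (hz : z ∈ Z J E (j+1)) : z ∈ B J E (j+1) := by
  obtain ⟨n, φ, rfl, hφ⟩ := cocycle_rep J z hz
  -- descend φ to the range of dd (j+1) j
  let d := dd J n (j+1) j
  have hk : LinearMap.ker d ≤ LinearMap.ker φ := by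
    intro y hy
    obtain ⟨w, rfl⟩ := dd_exact J n j y hy
    exact LinearMap.congr_fun hφ w
  let φ' : LinearMap.range d →ₗ[R] E :=
    (LinearMap.ker d).liftQ φ hk ∘ₗ d.quotKerEquivRange.symm.toLinearMap
  obtain ⟨ψ, hψ⟩ := Module.Injective.out (LinearMap.range d).subtype
    (Submodule.injective_subtype _) φ'
  refine ⟨mk J n ψ, ?_⟩
  rw [D_mk]
  congr 1
  ext y
  have := hψ ⟨d y, y, rfl⟩
  refine this.trans ?_
  change (LinearMap.ker d).liftQ φ hk (d.quotKerEquivRange.symm ⟨d y, _⟩) = _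
  have h2 : d.quotKerEquivRange.symm ⟨d y, y, rfl⟩ = (LinearMap.ker d).mkQ y := by
    rw [LinearEquiv.symm_apply_eq]; rfl
  rw [h2]; simp

/-- torsion elements give degree zero cocycles -/
def unitMap (n : ℕ) (v : N) (hv : ∀ r ∈ J ^ n, r • v = 0) : (R ⧸ J ^ n) →ₗ[R] N :=
  (J ^ n).liftQ (LinearMap.toSpanSingleton R N v) (fun r hr => by simpa using hv r hr)

lemma unitMap_mk (n : ℕ) (v : N) (hv : ∀ r ∈ J ^ n, r • v = 0) (r : R) :
    unitMap J n v hv (Ideal.Quotient.mk _ r) = r • v := rfl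

lemma eps_cocycle (n : ℕ) (g : (R ⧸ J ^ n) →ₗ[R] N) :
    mk J n (g ∘ₗ eps J n) ∈ Z J N 0 := by
  rw [mem_Z, D_mk]
  apply mk_of_zero
  ext y
  have := (eps_exact J n (dd J n 1 0 y)).2 ⟨y, rfl⟩
  simp [this]

lemma H0_surj (g : N →ₗ[R] N') (hg : Function.Surjective g) (hN : Tors J N)
    (z : Cx J 0 N') (hz : z ∈ Z J N' 0) : ∃ w ∈ Z J N 0, mapC J 0 g w = z := by
  obtain ⟨n, φ, rfl, hφ⟩ := cocycle_rep J z hz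
  obtain ⟨y1, hy1⟩ := eps_surj J n 1
  obtain ⟨v, hv⟩ := hg (φ y1)
  obtain ⟨m, hm⟩ := hN v
  have hm' : ∀ r ∈ J ^ (max n m), r • v = 0 := fun r hr =>
    hm r (Ideal.pow_le_pow_right (le_max_right n m) hr)
  refine ⟨_, eps_cocycle J _ (unitMap J _ v hm'), ?_⟩
  rw [mapC_mk, ← mk_tt J (le_max_left n m) φ]
  congr 1
  ext y
  obtain ⟨r, hr⟩ := Ideal.Quotient.mk_surjective (eps J (max n m) y)
  simp only [LinearMap.comp_apply, ← hr, unitMap_mk, map_smul, hv]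
  rw [← sub_eq_zero, ← map_smul, ← map_sub]
  obtain ⟨w, hw⟩ := (eps_exact J n (r • y1 - tt J (le_max_left n m) 0 y)).1 (by
    rw [map_sub, map_smul, hy1, eps_tt, ← hr, sub_eq_zero, Ideal.Quotient.factor_mk]
    rw [Algebra.smul_def, mul_one]; rfl)
  rw [← hw]
  exact LinearMap.congr_fun hφ w

/-- annihilation in degree zero -/
lemma ann0 (r : R) (h : ∀ z ∈ Z J N 0, r • z ∈ B J N 0) (n : ℕ) (v : N)
    (hv : ∀ r ∈ J ^ n, r • v = 0) : r • v = 0 := by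
  obtain ⟨b, hb⟩ := h _ (eps_cocycle J n (unitMap J n v hv))
  change D J 0 0 b = _ at hb
  rw [D00, ← map_smul] at hb
  obtain ⟨n', h', h0⟩ := mk_zero J _ hb.symm
  obtain ⟨y, hy⟩ := eps_surj J n' 1
  have := LinearMap.congr_fun h0 y
  simp only [LinearMap.comp_apply, LinearMap.smul_apply, eps_tt, hy, map_one,
    LinearMap.zero_apply] at this
  have h1 := unitMap_mk J n v hv 1
  rw [map_one, one_smul] at h1
  rwa [h1] at this

section tors

variable (N) in
/-- the torsion submodule -/
def Gamma : Submodule R N where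
  carrier := {v | ∃ n : ℕ, ∀ r ∈ J ^ n, r • v = 0}
  add_mem' := by
    rintro a b ⟨n, h⟩ ⟨m, h'⟩
    refine ⟨max n m, fun r hr => ?_⟩
    rw [smul_add, h r (Ideal.pow_le_pow_right (le_max_left n m) hr),
      h' r (Ideal.pow_le_pow_right (le_max_right n m) hr), add_zero]
  zero_mem' := ⟨0, by simp⟩
  smul_mem' := by
    rintro s a ⟨n, h⟩
    exact ⟨n, fun r hr => by rw [smul_comm, h r hr, smul_zero]⟩

lemma tors_unif (L : Submodule R N) (hL : L.FG) (h : ∀ v ∈ L, ∃ n : ℕ, ∀ r ∈ J ^ n, r • v = 0) :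
    ∃ n : ℕ, ∀ v ∈ L, ∀ r ∈ J ^ n, r • v = 0 := by
  obtain ⟨s, rfl⟩ := hL
  choose! f hf using h
  refine ⟨s.sup f, fun v hv r hr => ?_⟩
  induction hv using Submodule.span_induction with
  | mem x hx => exact hf x (Submodule.subset_span hx) r (Ideal.pow_le_pow_right (Finset.le_sup hx) hr)
  | zero => simp
  | add x y _ _ hx hy => rw [smul_add, hx, hy, add_zero]
  | smul a x _ hx => rw [smul_comm, hx, smul_zero]

variable [IsNoetherianRing R]

lemma gamma_inj (E : Type u) [AddCommGroup E] [Module R E] [Module.Injective R E] :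
    Module.Injective R (Gamma J E) := by
  refine Module.Baer.injective ?_
  intro I g
  obtain ⟨k, hk⟩ := tors_unif J (LinearMap.range ((Gamma J E).subtype ∘ₗ g))
    (by
      have : Module.Finite R I := Module.Finite.of_fg (IsNoetherian.noetherian I)
      rw [LinearMap.range_eq_map]
      exact Module.Finite.fg_top.map _)
    (by rintro _ ⟨y, rfl⟩; exact (g y).2)
  obtain ⟨c, hc⟩ := Ideal.exists_pow_inf_eq_pow_smul (M := R) J I
  have hc' : ∀ y (hy : y ∈ I), y ∈ J ^ (c + k) → g ⟨y, hy⟩ = 0 := by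
    intro y hy hyJ
    have h1 : y ∈ J ^ (c+k) • (⊤ : Submodule R R) ⊓ I := ⟨by simpa using hyJ, hy⟩
    rw [hc (c+k) (by omega), Nat.add_sub_cancel_left] at h1
    have h2 : y ∈ J ^ k • I := Submodule.smul_mono le_rfl inf_le_right h1
    have h3 : ∀ w ∈ J ^ k • I, ∃ hw : w ∈ I, g ⟨w, hw⟩ = 0 := by
      intro w hw
      induction hw using Submodule.smul_induction_on' with
      | smul r hr n hn =>
        refine ⟨I.smul_mem r hn, ?_⟩
        have := hk (g ⟨n, hn⟩ : E) ⟨⟨n, hn⟩, rfl⟩ r hr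
        apply Subtype.ext
        rw [← SetLike.mk_smul_mk I r n hn, map_smul]
        exact this
      | add a ha b hb iha ihb =>
        obtain ⟨ha, ha'⟩ := iha
        obtain ⟨hb, hb'⟩ := ihb
        refine ⟨I.add_mem ha hb, ?_⟩
        have := map_add g ⟨a, ha⟩ ⟨b, hb⟩
        rw [ha', hb', add_zero] at this
        exact this
    exact (h3 y h2).2
  -- extend to R / J^(c+k)
  let q := (J ^ (c+k)).mkQ
  let p : I →ₗ[R] R ⧸ J ^ (c+k) := q ∘ₗ I.subtype
  have hp : LinearMap.ker p ≤ LinearMap.ker ((Gamma J E).subtype ∘ₗ g) := by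
    rintro ⟨y, hy⟩ h
    have : y ∈ J ^ (c+k) := (Submodule.Quotient.mk_eq_zero _).1 h
    have := hc' y hy this
    simp [this]
  let g' : LinearMap.range p →ₗ[R] E :=
    (LinearMap.ker p).liftQ _ hp ∘ₗ p.quotKerEquivRange.symm.toLinearMap
  obtain ⟨ψ, hψ⟩ := Module.Injective.out (LinearMap.range p).subtype
    (Submodule.injective_subtype _) g'
  have hψr : ∀ y, (ψ ∘ₗ q) y ∈ Gamma J E := by
    intro y
    refine ⟨c+k, fun r hr => ?_⟩
    rw [← map_smul]
    have : q (r • y) = 0 := (Submodule.Quotient.mk_eq_zero _).2 (Ideal.mul_mem_right y _ hr)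
    rw [LinearMap.comp_apply, this, map_zero]
  refine ⟨(ψ ∘ₗ q).codRestrict _ hψr, fun y hy => ?_⟩
  apply Subtype.ext
  have := hψ ⟨p ⟨y, hy⟩, _, rfl⟩
  refine this.trans ?_
  change (LinearMap.ker p).liftQ _ hp (p.quotKerEquivRange.symm ⟨p ⟨y, hy⟩, _⟩) = _
  have h2 : p.quotKerEquivRange.symm ⟨p ⟨y, hy⟩, _, rfl⟩ = (LinearMap.ker p).mkQ ⟨y, hy⟩ := by
    rw [LinearEquiv.symm_apply_eq]; rfl
  rw [h2]; simp

lemma exists_tors_inj (hN : Tors J N) : ∃ (E : Type u) (_ : AddCommGroup E) (_ : Module R E),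
    Module.Injective R E ∧ Tors J E ∧ ∃ f : N →ₗ[R] E, Function.Injective f := by
  obtain ⟨⟨I, hI, f, hf⟩⟩ := EnoughInjectives.presentation (ModuleCat.of R N)
  have hI' : Module.Injective R I := (Module.injective_iff_injective_object R I).2 hI
  have hinj : Function.Injective f.hom := (ModuleCat.mono_iff_injective _).1 hf
  refine ⟨Gamma J I, inferInstance, inferInstance, gamma_inj J I, ?_, ?_⟩
  · rintro ⟨v, n, hv⟩
    exact ⟨n, fun r hr => Subtype.ext (hv r hr)⟩
  · refine ⟨f.hom.codRestrict _ fun y => ?_, fun a b h => hinj (congrArg Subtype.val h)⟩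
    obtain ⟨n, hn⟩ := hN y
    exact ⟨n, fun r hr => by rw [← map_smul, hn r hr, map_zero]⟩

lemma tors_vanish (j : ℕ) : ∀ (L : Type u) [AddCommGroup L] [Module R L], Tors J L →
    ∀ z ∈ Z J L (j+1), z ∈ B J L (j+1) := by
  induction j with
  | zero =>
    intro L _ _ hL z hz
    obtain ⟨E, _, _, hE, hET, f, hf⟩ := exists_tors_inj J hL
    obtain ⟨e, he⟩ := inj_vanish J E _ (mapC_Z J f hz)
    obtain ⟨w, hw, hw'⟩ := H0_surj J (LinearMap.range f).mkQ (Submodule.mkQ_surjective _) hET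
      (mapC J 0 (LinearMap.range f).mkQ e) (by
        rw [mem_Z, ← mapC_D]
        change mapC J 1 _ (D J 0 1 e) = 0
        change D J 0 1 e = _ at he
        rw [he]
        exact mapC_cx J _ _ (by simp) _)
    obtain ⟨l, hl⟩ := mapC_exact J f (LinearMap.range f).mkQ hf (by simp) (e - w) (by
      rw [map_sub, hw', sub_self])
    refine ⟨l, mapC_inj J f hf ?_⟩
    rw [mapC_D, ← he]
    change D J 0 1 _ = D J 0 1 _
    change mapC J 0 f l = _ at hl
    change D J 0 1 w = 0 at hw
    change D J 0 1 (mapC J 0 f l) = _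
    rw [hl, map_sub, hw, sub_zero]
  | succ j ih =>
    intro L _ _ hL z hz
    obtain ⟨E, _, _, hE, hET, f, hf⟩ := exists_tors_inj J hL
    obtain ⟨e, he⟩ := inj_vanish J E _ (mapC_Z J f hz)
    change Cx J (j+1) E at e
    change D J (j+1) (j+1+1) e = _ at he
    obtain ⟨b, hb⟩ := ih (E ⧸ LinearMap.range f) (by
        intro v
        obtain ⟨v, rfl⟩ := Submodule.mkQ_surjective _ v
        obtain ⟨n, hn⟩ := hET v
        exact ⟨n, fun r hr => by rw [← map_smul, hn r hr, map_zero]⟩)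
      (mapC J (j+1) (LinearMap.range f).mkQ e) (by
        rw [mem_Z, ← mapC_D, he]
        exact mapC_cx J _ _ (by simp) _)
    obtain ⟨b, rfl⟩ := mapC_surj J (LinearMap.range f).mkQ (Submodule.mkQ_surjective _) b
    rw [← mapC_D] at hb
    obtain ⟨l, hl⟩ := mapC_exact J f (LinearMap.range f).mkQ hf (by simp)
      (e - D J (j+1-1) (j+1) b) (by
      rw [map_sub, hb, sub_self])
    refine ⟨l, mapC_inj J f hf ?_⟩
    rw [mapC_D, ← he]
    change D J (j+1) (j+1+1) (mapC J (j+1) f l) = _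
    rw [hl, map_sub, D_D, sub_zero]

end tors
end LC
end
end partc


namespace LC
section core
variable {R : Type u} [CommRing R] (J : Ideal R)
variable {M M' Q : Type u} [AddCommGroup M] [Module R M] [AddCommGroup M'] [Module R M']
  [AddCommGroup Q] [Module R Q]

lemma core {ι : Type} [Fintype ι] (f : ι → (M' →ₗ[R] M)) (bb : ι → R) (fx : M' →ₗ[R] M)
    (hfx : fx = ∑ k, bb k • f k) (hfi : Function.Injective fx) (q : M →ₗ[R] Q)
    (hq : Function.Surjective q) (hex : ∀ y, q y = 0 → ∃ w, fx w = y) (hcx : ∀ w, q (fx w) = 0)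
    (π : M →ₗ[R] M') (i : ℕ)
    (hsurj : ∀ z ∈ Z J M' (i+1), ∃ y ∈ Z J M (i+1), mapC J _ π y = z)
    (hinj : ∀ y ∈ Z J M (i+1), mapC J _ π y ∈ B J M' (i+1) → y ∈ B J M (i+1))
    (h1 : ∀ y ∈ Z J M (i+1), ∀ k, bb k • mapC J _ π y ∈ B J M' (i+1))
    (h2 : ∀ w ∈ Z J M' i, ∀ k, mapC J _ (f k) w ∈ B J M i) :
    Nonempty (H J Q i ≃ₗ[R] (H J M i × H J M (i+1))) := by
  let W : Submodule R (Z J M i × Z J M (i+1) × (ι → Cx J i M')) :=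
    { carrier := {p | ∀ k, D J i (i+1) (p.2.2 k) = bb k • mapC J (i+1) π p.2.1}
      add_mem' := by
        intro a b ha hb k
        have ha := ha k
        have hb := hb k
        simp only [Prod.snd_add, Prod.fst_add, Pi.add_apply, map_add, Submodule.coe_add,
          smul_add, ha, hb]
      zero_mem' := by intro k; simp
      smul_mem' := by
        intro r a ha k
        have ha := ha k
        simp only [Prod.smul_snd, Prod.smul_fst, Pi.smul_apply, map_smul, Submodule.coe_smul,
          ha]
        rw [smul_comm] }
  have hfs : ∀ {j : ℕ} (c : Cx J j M'), mapC J j fx c = ∑ k, bb k • mapC J j (f k) c := by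
    intro j c
    rw [hfx, map_sum]
    simp
  let s : (ι → Cx J i M') →ₗ[R] Cx J i M := ∑ k, mapC J i (f k) ∘ₗ LinearMap.proj k
  have hs : ∀ u, s u = ∑ k, mapC J i (f k) (u k) := by intro u; simp [s]
  have hDs : ∀ (y : Cx J (i+1) M') (u : ι → Cx J i M'), (∀ k, D J i (i+1) (u k) = bb k • y) →
      D J i (i+1) (s u) = mapC J (i+1) fx y := by
    intro y u hu
    rw [hs, map_sum, hfs]
    refine Finset.sum_congr rfl fun k _ => ?_
    rw [← mapC_D, hu, map_smul]
  let c0 : W →ₗ[R] Cx J i M :=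
    ((Z J M i).subtype ∘ₗ LinearMap.fst R _ _ + s ∘ₗ LinearMap.snd R _ _ ∘ₗ LinearMap.snd R _ _) ∘ₗ
      W.subtype
  have hc0 : ∀ w : W, c0 w = w.1.1 + s w.1.2.2 := fun w => rfl
  have hDc : ∀ w : W, D J i (i+1) (c0 w) = mapC J (i+1) fx (mapC J (i+1) π w.1.2.1) := by
    intro w
    rw [hc0, map_add, hDs _ _ w.2, (mem_Z J).1 w.1.1.2, zero_add]
  let g0 : W →ₗ[R] Z J Q i := (mapC J i q ∘ₗ c0).codRestrict _ (by
    intro w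
    rw [mem_Z, LinearMap.comp_apply, ← mapC_D, hDc]
    exact mapC_cx J _ _ hcx _)
  -- key step
  have key : ∀ (w : W) (z' : Cx J i M'), mapC J (i+1) π w.1.2.1 = D J i (i+1) z' →
      s w.1.2.2 - mapC J i fx z' ∈ B J M i := by
    intro w z' hz'
    rw [hs, hfs, ← Finset.sum_sub_distrib]
    refine Submodule.sum_mem _ fun k _ => ?_
    rw [← map_smul, ← map_sub]
    apply h2
    rw [mem_Z, map_sub, map_smul, ← hz', w.2 k, sub_self]
  refine equivOfSurj (W := W) ((Submodule.mkQ _) ∘ₗ g0)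
    (((Submodule.mkQ _).prodMap (Submodule.mkQ _)) ∘ₗ
      ((LinearMap.fst R _ _).prod (LinearMap.fst R _ _ ∘ₗ LinearMap.snd R _ _)) ∘ₗ W.subtype)
    ?_ ?_ ?_
  · intro h
    obtain ⟨⟨c, hc⟩, rfl⟩ := Submodule.mkQ_surjective _ h
    obtain ⟨c, rfl⟩ := mapC_surj J q hq c
    rw [mem_Z, ← mapC_D] at hc
    obtain ⟨z, hz⟩ := mapC_exact J fx q hfi hex _ hc
    have hzZ : z ∈ Z J M' (i+1) := by
      rw [mem_Z]
      apply mapC_inj J fx hfi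
      rw [mapC_D, hz, D_D, map_zero]
    obtain ⟨y, hy, rfl⟩ := hsurj z hzZ
    choose u hu using fun k => h1 y hy k
    change ∀ k, D J i (i+1) (u k) = _ at hu
    have hb : c - s u ∈ Z J M i := by
      rw [mem_Z, map_sub, hDs _ u hu, hz, sub_self]
    refine ⟨⟨(⟨_, hb⟩, ⟨y, hy⟩, u), hu⟩, ?_⟩
    refine congrArg (Submodule.mkQ _) (Subtype.ext ?_)
    change mapC J i q (c - s u + s u) = mapC J i q c
    rw [sub_add_cancel]
  · rintro ⟨a, b⟩
    obtain ⟨b1, rfl⟩ := Submodule.mkQ_surjective _ a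
    obtain ⟨y, rfl⟩ := Submodule.mkQ_surjective _ b
    choose u hu using fun k => h1 y y.2 k
    exact ⟨⟨(b1, y, u), hu⟩, rfl⟩
  · intro w
    have e1 : ((Submodule.mkQ ((B J Q i).submoduleOf (Z J Q i))) ∘ₗ g0) w = 0 ↔
        mapC J i q (c0 w) ∈ B J Q i := by
      rw [LinearMap.comp_apply, Submodule.mkQ_apply, Submodule.Quotient.mk_eq_zero]; rfl
    have e2 : (((Submodule.mkQ ((B J M i).submoduleOf (Z J M i))).prodMap
      (Submodule.mkQ ((B J M (i+1)).submoduleOf (Z J M (i+1))))) ∘ₗ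
      ((LinearMap.fst R _ _).prod (LinearMap.fst R _ _ ∘ₗ LinearMap.snd R _ _)) ∘ₗ W.subtype) w = 0 ↔
        (w.1.1 : Cx J i M) ∈ B J M i ∧ (w.1.2.1 : Cx J (i+1) M) ∈ B J M (i+1) := by
      refine Prod.ext_iff.trans (and_congr ?_ ?_)
      · exact Submodule.Quotient.mk_eq_zero _
      · exact Submodule.Quotient.mk_eq_zero _
    rw [e1, e2]
    constructor
    · rintro ⟨q', hq'⟩
      obtain ⟨b', rfl⟩ := mapC_surj J q hq q'
      rw [← mapC_D] at hq'
      obtain ⟨z', hz'⟩ := mapC_exact J fx q hfi hex (c0 w - D J (i-1) i b') (by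
        rw [map_sub, hq', sub_self])
      have hz : mapC J (i+1) π w.1.2.1 = D J i (i+1) z' := by
        apply mapC_inj J fx hfi
        rw [← hDc, mapC_D, hz', map_sub, D_D, sub_zero]
      refine ⟨?_, hinj _ w.1.2.1.2 ⟨z', hz.symm⟩⟩
      have hk := key w z' hz
      have : (w.1.1 : Cx J i M) = D J (i-1) i b' - (s w.1.2.2 - mapC J i fx z') := by
        rw [hz', hc0]; abel
      rw [this]
      exact Submodule.sub_mem _ ⟨b', rfl⟩ hk
    · rintro ⟨hb, hy⟩
      obtain ⟨z', hz'⟩ := mapC_B J π hy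
      change D J i (i+1) z' = _ at hz'
      have hk := key w z' hz'.symm
      have h3 := mapC_B J q (Submodule.add_mem _ hb hk)
      have h4 : mapC J i q (c0 w) = mapC J i q (w.1.1 + (s w.1.2.2 - mapC J i fx z')) := by
        rw [hc0]; simp only [map_add, map_sub, mapC_cx J fx q hcx, sub_zero]
      rwa [h4]

end core

lemma exists_sum {R : Type u} [CommRing R] (I I' : Ideal R) (x : R) (hx : x ∈ I * I') :
    ∃ (ι : Type) (_ : Fintype ι) (a b : ι → R), (∀ k, a k ∈ I) ∧ (∀ k, b k ∈ I') ∧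
      x = ∑ k, b k * a k := by
  induction hx using Submodule.mul_induction_on' with
  | mem_mul_mem m hm n hn =>
    exact ⟨Unit, inferInstance, fun _ => m, fun _ => n, fun _ => hm, fun _ => hn, by simp [mul_comm]⟩
  | add x hx y hy ihx ihy =>
    obtain ⟨ι, _, a, b, ha, hb, h⟩ := ihx
    obtain ⟨ι', _, a', b', ha', hb', h'⟩ := ihy
    refine ⟨ι ⊕ ι', inferInstance, Sum.elim a a', Sum.elim b b', ?_, ?_, ?_⟩
    · rintro (k | k); exacts [ha k, ha' k]
    · rintro (k | k); exacts [hb k, hb' k]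
    · simp [h, h']

end LC

open LC

theorem localCohomology_splitting
    {R : Type u} [CommRing R] [IsNoetherianRing R] [IsLocalRing R]
    (M : Type u) [AddCommGroup M] [Module R M] [Module.Finite R M]
    (t n₀ : ℕ)
    (ht : sInf {i | ¬ Module.Finite R (lcoh (maximalIdeal R) i M)} = t) (ht0 : 0 < t)
    (hn₀ : 1 ≤ n₀)
    (hann : ∀ i < t, ∀ (a : lcoh (maximalIdeal R) i M),
      ∀ r ∈ maximalIdeal R ^ n₀, r • a = 0)
    (x : R) (hx : x ∈ maximalIdeal R ^ (2 * n₀))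
    (hfr : ∀ m : M, x • m = 0 → ∃ n : ℕ, ∀ r ∈ maximalIdeal R ^ n, r • m = 0) :
    ∀ i : ℕ, i < t - 1 →
      Nonempty ((lcoh (maximalIdeal R) i (M ⧸ (Ideal.span {x} • ⊤ : Submodule R M)))
        ≃ₗ[R] (lcoh (maximalIdeal R) i M × lcoh (maximalIdeal R) (i + 1) M)) := by
  intro i hi
  set J := maximalIdeal R with hJ
  have hann' : ∀ j < t, ∀ z ∈ Z J M j, ∀ r ∈ J ^ n₀, r • z ∈ B J M j := by
    intro j hj z hz r hr
    obtain ⟨e⟩ := lcoh_equiv J M j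
    have h1 := hann j hj (e (Submodule.mkQ _ ⟨z, hz⟩)) r hr
    rw [← map_smul, ← map_smul] at h1
    have h2 := (map_eq_zero_iff e e.injective).1 h1
    have h3 := (Submodule.Quotient.mk_eq_zero ((B J M j).submoduleOf (Z J M j))).1 h2
    exact h3
  let L : Submodule R M := LinearMap.ker (LinearMap.lsmul R M x)
  have hLx : ∀ v, v ∈ L ↔ x • v = 0 := fun v => Iff.rfl
  have hLann : ∀ a ∈ J ^ n₀, ∀ v ∈ L, a • v = 0 := by
    intro a ha v hv
    obtain ⟨n, hn⟩ := hfr v hv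
    exact ann0 J a (fun z hz => hann' 0 ht0 z hz a ha) n v hn
  have hLT : Tors J L := by
    rintro ⟨v, hv⟩
    obtain ⟨n, hn⟩ := hfr v hv
    exact ⟨n, fun r hr => Subtype.ext (hn r hr)⟩
  have hLi := Submodule.injective_subtype L
  have hLe : ∀ y, L.mkQ y = 0 → ∃ w, L.subtype w = y := fun y hy =>
    ⟨⟨y, (Submodule.Quotient.mk_eq_zero _).1 hy⟩, rfl⟩
  have hLc : ∀ w, L.mkQ (L.subtype w) = 0 := fun w => (Submodule.Quotient.mk_eq_zero _).2 w.2
  have hsurj : ∀ j, ∀ z ∈ Z J (M ⧸ L) j, ∃ y ∈ Z J M j, mapC J _ L.mkQ y = z := by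
    intro j z hz
    obtain ⟨c, rfl⟩ := mapC_surj J L.mkQ (Submodule.mkQ_surjective _) z
    rw [mem_Z, ← mapC_D] at hz
    obtain ⟨l, hl⟩ := mapC_exact J L.subtype L.mkQ hLi hLe _ hz
    obtain ⟨l', hl'⟩ := tors_vanish J j L hLT l (by
      rw [mem_Z]
      apply mapC_inj J L.subtype hLi
      rw [mapC_D, hl, D_D, map_zero])
    change Cx J j L at l'
    change D J j (j+1) l' = l at hl'
    refine ⟨c - mapC J j L.subtype l', ?_, ?_⟩
    · rw [mem_Z, map_sub, ← mapC_D, hl', hl, sub_self]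
    · rw [map_sub, mapC_cx J _ _ hLc, sub_zero]
  have hinj : ∀ y ∈ Z J M (i+1), mapC J _ L.mkQ y ∈ B J (M ⧸ L) (i+1) → y ∈ B J M (i+1) := by
    rintro y hy ⟨w, hw⟩
    obtain ⟨c, rfl⟩ := mapC_surj J L.mkQ (Submodule.mkQ_surjective _) w
    rw [← mapC_D] at hw
    obtain ⟨l, hl⟩ := mapC_exact J L.subtype L.mkQ hLi hLe (y - D J (i+1-1) (i+1) c) (by
      rw [map_sub, hw, sub_self])
    have hlB := tors_vanish J i L hLT l (by
      rw [mem_Z]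
      apply mapC_inj J L.subtype hLi
      rw [mapC_D, hl, map_sub, D_D, map_zero, (mem_Z J).1 hy, sub_zero])
    have := Submodule.add_mem _ (mapC_B J L.subtype hlB) (⟨c, rfl⟩ : D J (i+1-1) (i+1) c ∈ B J M (i+1))
    rwa [hl, sub_add_cancel] at this
  obtain ⟨ι, _, a, b, ha, hb, hab⟩ := exists_sum (J ^ n₀) (J ^ n₀) x (by
    rwa [← pow_add, ← two_mul])
  let f : ι → ((M ⧸ L) →ₗ[R] M) := fun k => L.liftQ (LinearMap.lsmul R M (a k))
    (fun v hv => hLann (a k) (ha k) v hv)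
  let fx : (M ⧸ L) →ₗ[R] M := L.liftQ (LinearMap.lsmul R M x) le_rfl
  have hfxa : ∀ v, fx (L.mkQ v) = x • v := fun v => rfl
  have hfa : ∀ k v, f k (L.mkQ v) = a k • v := fun k v => rfl
  have hfx : fx = ∑ k, b k • f k := by
    ext v
    change x • v = (∑ k, b k • f k) (L.mkQ v)
    simp only [LinearMap.sum_apply, LinearMap.smul_apply, hfa, smul_smul]
    rw [hab, Finset.sum_smul]
  have hfi : Function.Injective fx := by
    rw [injective_iff_map_eq_zero]
    intro v hv
    obtain ⟨v, rfl⟩ := Submodule.mkQ_surjective _ v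
    exact (Submodule.Quotient.mk_eq_zero _).2 hv
  obtain ⟨e⟩ := core J f b fx hfx hfi (Ideal.span {x} • ⊤ : Submodule R M).mkQ
    (Submodule.mkQ_surjective _) (by
      intro y hy
      have hy := (Submodule.Quotient.mk_eq_zero _).1 hy
      rw [Submodule.ideal_span_singleton_smul, Submodule.mem_smul_pointwise_iff_exists] at hy
      obtain ⟨v, -, rfl⟩ := hy
      exact ⟨L.mkQ v, rfl⟩) (by
      intro w
      obtain ⟨v, rfl⟩ := Submodule.mkQ_surjective _ w
      refine (Submodule.Quotient.mk_eq_zero _).2 ?_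
      exact Submodule.smul_mem_smul (Ideal.mem_span_singleton_self x) trivial)
    L.mkQ i (hsurj (i+1)) hinj (by
      intro y hy k
      rw [← map_smul]
      exact mapC_B J _ (hann' (i+1) (by omega) y hy _ (hb k))) (by
      intro w hw k
      obtain ⟨y, hy, rfl⟩ := hsurj i w hw
      rw [← mapC_comp]
      have : f k ∘ₗ L.mkQ = a k • LinearMap.id := by ext v; rfl
      rw [this, map_smul, LinearMap.smul_apply, mapC_id]
      exact hann' i (by omega) y hy _ (ha k))
  obtain ⟨e1⟩ := lcoh_equiv J (M ⧸ (Ideal.span {x} • ⊤ : Submodule R M)) i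
  obtain ⟨e2⟩ := lcoh_equiv J M i
  obtain ⟨e3⟩ := lcoh_equiv J M (i+1)
  exact ⟨e1.symm.trans (e.trans (e2.prodCongr e3))⟩
end
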